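/- If D ⊆ ℂⁿ is a k-hyperbolic domain, z ∈ D, and the Fridman invariant h^k_D(z) = 1 (i.e., for every r > 0 there is an injective holomorphic map g : 𝔹ₙ → D whose image contains the Kobayashi ball B^k_D(z,r)), then D is biholomorphic to the unit ball 𝔹ₙ. -/

import Mathlib

open Set Metric

noncomputable section

/-- The inverse hyperbolic tangent. -/
def artanh (x : ℝ) : ℝ := (1 / 2) * Real.log ((1 + x) / (1 - x))

variable {n : ℕ}

/-- `ℂⁿ` as a complex Euclidean space. -/
abbrev Cn (n : ℕ) := EuclideanSpace ℂ (Fin n)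

/-- The Lempert function of `D ⊆ ℂⁿ` (with values in `[0,∞]`):
`l_D(z,w) = inf { tanh⁻¹|λ| : φ : Δ → D holomorphic, φ(0) = z, φ(λ) = w }`. -/
def lempert (D : Set (Cn n)) (z w : Cn n) : ENNReal :=
  sInf {x : ENNReal | ∃ φ : ℂ → Cn n, DifferentiableOn ℂ φ (ball 0 1) ∧
    MapsTo φ (ball 0 1) D ∧ φ 0 = z ∧
    ∃ l : ℂ, l ∈ ball (0 : ℂ) 1 ∧ φ l = w ∧ x = ENNReal.ofReal (artanh ‖l‖)}

/-- The Carathéodory pseudodistance of `D ⊆ ℂⁿ`: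
`c_D(z,w) = sup { tanh⁻¹|f(w)| : f : D → Δ holomorphic, f(z) = 0 }`. -/
def cara (D : Set (Cn n)) (z w : Cn n) : ℝ :=
  sSup {x : ℝ | ∃ f : Cn n → ℂ, DifferentiableOn ℂ f D ∧ MapsTo f D (ball 0 1) ∧
    f z = 0 ∧ x = artanh ‖f w‖}

/-- The squeezing function of `D ⊆ ℂⁿ`:
`s_D(z) = sup { r : ∃ injective holomorphic f : D → 𝔹ₙ, f(z) = 0, r𝔹ₙ ⊆ f(D) }`,
with value `0` if no such map exists. -/
def squeeze (D : Set (Cn n)) (z : Cn n) : ℝ :=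
  sSup (insert (0 : ℝ) {r : ℝ | 0 < r ∧ ∃ f : Cn n → Cn n, DifferentiableOn ℂ f D ∧
    InjOn f D ∧ MapsTo f D (ball 0 1) ∧ f z = 0 ∧ ball (0 : Cn n) r ⊆ f '' D})

/-- The Fridman invariant of `D ⊆ ℂⁿ` with respect to a pseudodistance `d`:
`h^d_D(z) = sup { tanh r : B^d_D(z,r) ⊆ g(𝔹ₙ), g : 𝔹ₙ → D injective holomorphic }`. -/
def fridman (d : Cn n → Cn n → ℝ) (D : Set (Cn n)) (z : Cn n) : ℝ :=
  sSup (insert (0 : ℝ) {x : ℝ | ∃ r : ℝ, 0 ≤ r ∧ x = Real.tanh r ∧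
    ∃ g : Cn n → Cn n, DifferentiableOn ℂ g (ball 0 1) ∧ InjOn g (ball 0 1) ∧
      MapsTo g (ball 0 1) D ∧ {w ∈ D | d z w < r} ⊆ g '' ball 0 1})

/-- The Kobayashi–Royden pseudometric of `D ⊆ ℂⁿ`:
`κ_D(z;X) = inf { |λ| : φ : Δ → D holomorphic, φ(0) = z, λ φ'(0) = X }`. -/
def kappaRoyden (D : Set (Cn n)) (z X : Cn n) : ℝ :=
  sInf {x : ℝ | ∃ φ : ℂ → Cn n, DifferentiableOn ℂ φ (ball 0 1) ∧
    MapsTo φ (ball 0 1) D ∧ φ 0 = z ∧ ∃ l : ℂ, l • fderiv ℂ φ 0 1 = X ∧ x = ‖l‖}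

/-- The Kobayashi length of a curve `γ : [0,1] → D` in `D`. -/
def kobLength (D : Set (Cn n)) (γ : ℝ → Cn n) : ℝ :=
  ∫ t in (0:ℝ)..1, kappaRoyden D (γ t) (deriv γ t)

/-- `γ` is a `C¹` curve in `D` from `z` to `w`. -/
def IsCurve (D : Set (Cn n)) (γ : ℝ → Cn n) (z w : Cn n) : Prop :=
  ContDiffOn ℝ 1 γ (Icc 0 1) ∧ MapsTo γ (Icc 0 1) D ∧ γ 0 = z ∧ γ 1 = w

/-- The Kobayashi pseudodistance of `D ⊆ ℂⁿ`, i.e. the integrated form of the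
Kobayashi–Royden pseudometric. -/
def kobayashi (D : Set (Cn n)) (z w : Cn n) : ℝ :=
  sInf {L : ℝ | ∃ γ : ℝ → Cn n, IsCurve D γ z w ∧ kobLength D γ = L}


section partA
open Set Metric Filter Topology

section several
variable {E F : Type*} [NormedAddCommGroup E] [NormedSpace ℂ E] [NormedAddCommGroup F] [NormedSpace ℂ F]

theorem sv_fderiv_bound {f : E → F} {c : E} {R M : ℝ} (hR : 0 < R)
    (hf : DifferentiableOn ℂ f (ball c R)) (hM : ∀ x ∈ ball c R, ‖f x‖ ≤ M) :
    ‖fderiv ℂ f c‖ ≤ 2 * M / R := by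
  refine Complex.norm_fderiv_le_div_of_mapsTo_ball hf (fun x hx => ?_) hR
  rw [mem_closedBall, dist_eq_norm]
  have h1 := hM x hx
  have h2 := hM c (mem_ball_self hR)
  linarith [norm_sub_le (f x) (f c)]

theorem sv_lip_bound {f : E → F} {c : E} {R M : ℝ}
    (hf : DifferentiableOn ℂ f (ball c R)) (hM : ∀ x ∈ ball c R, ‖f x‖ ≤ M)
    {z : E} (hz : z ∈ ball c R) : ‖f z - f c‖ ≤ 2 * M / R * ‖z - c‖ := by
  have hR : 0 < R := nonempty_ball.mp ⟨_, hz⟩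
  rw [← dist_eq_norm, ← dist_eq_norm]
  refine Complex.dist_le_div_mul_dist_of_mapsTo_ball hf (fun x hx => ?_) hz
  rw [mem_closedBall, dist_eq_norm]
  have h1 := hM x hx
  have h2 := hM c (mem_ball_self hR)
  linarith [norm_sub_le (f x) (f c)]

theorem sv_taylor_bound {f : E → F} {c : E} {R M : ℝ}
    (hf : DifferentiableOn ℂ f (ball c R)) (hM : ∀ x ∈ ball c R, ‖f x‖ ≤ M)
    {z : E} (hz : z ∈ ball c R) :
    ‖f z - f c - fderiv ℂ f c (z - c)‖ ≤ 4 * M * (‖z - c‖ / R) ^ 2 := by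
  have hR : 0 < R := nonempty_ball.mp ⟨_, hz⟩
  have hd := sv_fderiv_bound hR hf hM
  have hc : DifferentiableAt ℂ f c := hf.differentiableAt (ball_mem_nhds _ hR)
  set A := fderiv ℂ f c with hA
  have key := Complex.dist_le_mul_div_pow_of_mapsTo_ball_of_isLittleO (n := 1)
    (f := fun w => f w - A (w - c)) (c := c) (z := z) (R₁ := R) (R₂ := 4 * M) ?_ ?_ ?_ hz
  · rw [dist_eq_norm, dist_eq_norm] at key
    simp only [sub_self, map_zero, sub_zero] at key
    rw [sub_right_comm]
    exact key
  · exact hf.sub (by fun_prop)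
  · intro x hx
    rw [mem_closedBall, dist_eq_norm]
    have h1 := hM x hx
    have h2 := hM c (mem_ball_self hR)
    have h3 : ‖A (x - c)‖ ≤ 2 * M := by
      refine (A.le_opNorm _).trans ?_
      have : ‖x - c‖ ≤ R := by rw [← dist_eq_norm]; exact (mem_ball.1 hx).le
      calc ‖A‖ * ‖x - c‖ ≤ (2 * M / R) * R := by
            refine mul_le_mul hd this (norm_nonneg _) ((norm_nonneg _).trans hd)
        _ = 2 * M := by field_simp
    simp only [sub_self, map_zero, sub_zero]
    calc ‖f x - A (x - c) - f c‖ ≤ ‖f x - A (x - c)‖ + ‖f c‖ := norm_sub_le _ _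
      _ ≤ ‖f x‖ + ‖A (x - c)‖ + ‖f c‖ := by gcongr; exact norm_sub_le _ _
      _ ≤ 4 * M := by linarith
  · have := hc.hasFDerivAt.isLittleO
    simp only [sub_self, map_zero, sub_zero, pow_one]
    refine (this.congr_left ?_).trans_isBigO (Asymptotics.isBigO_refl _ _).norm_right
    intro x; abel

theorem sv_limit [FiniteDimensional ℂ E] [FiniteDimensional ℂ F] {ι : Type*} (U : Ultrafilter ι)
    {f : ι → E → F} {g : E → F} {c : E} {R M : ℝ} (hR : 0 < R)
    (hf : ∀ᶠ j in (U : Filter ι), DifferentiableOn ℂ (f j) (ball c R) ∧ ∀ x ∈ ball c R, ‖f j x‖ ≤ M)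
    (hg : ∀ x ∈ ball c R, Tendsto (fun j => f j x) U (𝓝 (g x))) : DifferentiableAt ℂ g c := by
  have hb : ∀ᶠ j in (U : Filter ι), fderiv ℂ (f j) c ∈ closedBall (0 : E →L[ℂ] F) (2 * M / R) := by
    filter_upwards [hf] with j hj
    simpa using sv_fderiv_bound hR hj.1 hj.2
  have : ProperSpace (E →L[ℂ] F) := FiniteDimensional.proper ℂ _
  obtain ⟨A, -, hA⟩ := (isCompact_closedBall (0 : E →L[ℂ] F) (2 * M / R)).ultrafilter_le_nhds
    (U.map fun j => fderiv ℂ (f j) c) (le_principal_iff.2 hb)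
  have hA' : Tendsto (fun j => fderiv ℂ (f j) c) U (𝓝 A) := hA
  refine ⟨A, ?_⟩
  have key : ∀ x ∈ ball c R, ‖g x - g c - A (x - c)‖ ≤ 4 * M * (‖x - c‖ / R) ^ 2 := by
    intro x hx
    have h1 : Tendsto (fun j => ‖f j x - f j c - fderiv ℂ (f j) c (x - c)‖) U
        (𝓝 ‖g x - g c - A (x - c)‖) := by
      refine (((hg x hx).sub (hg c (mem_ball_self hR))).sub ?_).norm
      exact ((ContinuousLinearMap.apply ℂ F (x - c)).continuous.tendsto A).comp hA'
    refine le_of_tendsto h1 ?_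
    filter_upwards [hf] with j hj
    exact sv_taylor_bound hj.1 hj.2 hx
  rw [hasFDerivAt_iff_isLittleO]
  have : (fun x => g x - g c - A (x - c)) =O[𝓝 c] fun x => ‖x - c‖ ^ 2 := by
    refine Asymptotics.IsBigO.of_bound (4 * M / R ^ 2) ?_
    filter_upwards [ball_mem_nhds c hR] with x hx
    refine (key x hx).trans (le_of_eq ?_)
    rw [norm_pow, norm_norm]; field_simp
  refine this.trans_isLittleO ?_
  have h2 : (fun x : E => ‖x - c‖ ^ 2) =o[𝓝 c] fun x => ‖x - c‖ ^ 1 := by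
    have h3 : (fun x : ℝ => x ^ 2) =o[𝓝 0] fun x => x ^ 1 :=
      Asymptotics.isLittleO_pow_pow (by norm_num)
    refine h3.comp_tendsto (k := fun x : E => ‖x - c‖) ?_
    have : Continuous fun x : E => ‖x - c‖ := by fun_prop
    simpa using this.tendsto c
  simpa using h2

theorem sv_fderiv_apply [FiniteDimensional ℂ E] [FiniteDimensional ℂ F] {f : E → F} {s : Set E}
    (hs : IsOpen s) (hf : DifferentiableOn ℂ f s) (v : E) :
    DifferentiableOn ℂ (fun x => fderiv ℂ f x v) s := by
  intro c hc
  refine DifferentiableAt.differentiableWithinAt ?_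
  -- a ball where f is bounded
  have hcont : ContinuousAt f c := (hf.differentiableAt (hs.mem_nhds hc)).continuousAt
  obtain ⟨R, hR, hRs⟩ : ∃ R > 0, ball c R ⊆ s ∩ {x | ‖f x‖ < ‖f c‖ + 1} := by
    refine Metric.mem_nhds_iff.1 (inter_mem (hs.mem_nhds hc) ?_)
    exact hcont.norm.eventually_lt_const (by linarith [norm_nonneg (f c)])
  set M := ‖f c‖ + 1
  have hfM : ∀ x ∈ ball c R, ‖f x‖ ≤ M := fun x hx => (hRs hx).2.le
  have hfd : DifferentiableOn ℂ f (ball c R) := hf.mono fun x hx => (hRs hx).1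
  set r := R / 4 with hr
  set ε : ℕ → ℂ := fun k => 1 / ((k : ℂ) + 1) with hε
  have hε0 : Tendsto ε atTop (𝓝 0) := tendsto_one_div_add_atTop_nhds_zero_nat
  have hεne : ∀ k, ε k ≠ 0 := fun k => by
    simp only [hε]; exact one_div_ne_zero (Nat.cast_add_one_ne_zero k)
  have hεv : Tendsto (fun k => ε k • v) atTop (𝓝 0) := by simpa using hε0.smul_const v
  refine sv_limit (U := hyperfilter ℕ) (f := fun k x => (ε k)⁻¹ • (f (x + ε k • v) - f x))
    (R := r) (M := 2 * M / (R / 2) * ‖v‖) (by positivity) ?_ ?_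
  · have hsmall : ∀ᶠ k in atTop, ‖ε k • v‖ < r := by
      have := hεv.norm
      rw [norm_zero] at this
      exact this.eventually_lt_const (by positivity)
    filter_upwards [Nat.hyperfilter_le_atTop hsmall] with k hk
    constructor
    · refine DifferentiableOn.const_smul (DifferentiableOn.sub ?_ ?_) _
      · refine hfd.comp (by fun_prop) ?_
        intro x hx
        rw [mem_ball, dist_eq_norm] at hx ⊢
        calc ‖x + ε k • v - c‖ = ‖(x - c) + ε k • v‖ := by congr 1; abel
          _ ≤ _ := norm_add_le _ _
          _ < R := by linarith
      · exact hfd.mono (ball_subset_ball (by linarith))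
    · intro x hx
      have hsub : ball x (R / 2) ⊆ ball c R := by
        refine ball_subset_ball' ?_
        have := mem_ball.1 hx
        linarith
      have := sv_lip_bound (hfd.mono hsub) (fun y hy => hfM y (hsub hy))
        (z := x + ε k • v) (by rw [mem_ball, dist_eq_norm]; simp only [add_sub_cancel_left]; linarith)
      rw [norm_smul, norm_inv]
      rw [add_sub_cancel_left, norm_smul] at this
      have hpos : 0 < ‖ε k‖ := norm_pos_iff.2 (hεne k)
      rw [inv_mul_le_iff₀ hpos]
      calc _ ≤ _ := this
        _ = _ := by ring
  · intro x hx
    have hx' : x ∈ ball c R := ball_subset_ball (by linarith) hx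
    have hd : HasFDerivAt f (fderiv ℂ f x) x :=
      (hfd.differentiableAt (isOpen_ball.mem_nhds hx')).hasFDerivAt
    refine Tendsto.mono_left ?_ Nat.hyperfilter_le_atTop
    refine (hasFDerivWithinAt_univ.2 hd).lim hεv (.of_forall fun _ => mem_univ _) ?_
    refine tendsto_const_nhds.congr fun k => ?_
    rw [smul_smul, inv_mul_cancel₀ (hεne k), one_smul]

theorem sv_contDiffOn_nat [FiniteDimensional ℂ E] [FiniteDimensional ℂ F] {s : Set E}
    (hs : IsOpen s) (k : ℕ) : ∀ {f : E → F}, DifferentiableOn ℂ f s → ContDiffOn ℂ k f s := by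
  induction k with
  | zero => intro f hf; exact contDiffOn_zero.2 hf.continuousOn
  | succ k ih =>
    intro f hf
    push_cast
    rw [contDiffOn_succ_iff_fderiv_of_isOpen hs]
    refine ⟨hf, fun h => by simp at h, ?_⟩
    rw [contDiffOn_clm_apply]
    exact fun v => ih (sv_fderiv_apply hs hf v)

theorem sv_contDiffAt [FiniteDimensional ℂ E] [FiniteDimensional ℂ F] {s : Set E} {f : E → F}
    (hs : IsOpen s) (hf : DifferentiableOn ℂ f s) {x : E} (hx : x ∈ s) : ContDiffAt ℂ 1 f x :=
  ((sv_contDiffOn_nat hs 1 hf).contDiffAt (hs.mem_nhds hx))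

theorem sv_fderiv [FiniteDimensional ℂ E] [FiniteDimensional ℂ F] {s : Set E} {f : E → F}
    (hs : IsOpen s) (hf : DifferentiableOn ℂ f s) : DifferentiableOn ℂ (fderiv ℂ f) s := by
  have := sv_contDiffOn_nat hs 2 hf
  have h2 : ContDiffOn ℂ ((1 : ℕ) + 1) f s := by exact_mod_cast this
  rw [contDiffOn_succ_iff_fderiv_of_isOpen hs] at h2
  exact h2.2.2.differentiableOn (by simp)

end several

/-- Hurwitz-type existence of zeros. -/
theorem exists_zero_of_sphere {k : ℂ → ℂ} {t₀ : ℂ} {r R ε : ℝ} (hr : 0 < r) (hrR : r < R)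
    (hk : DifferentiableOn ℂ k (ball t₀ R)) (hs : ∀ t ∈ sphere t₀ r, ε ≤ ‖k t‖)
    (h0 : ‖k t₀‖ < ε / 3) : ∃ t ∈ closedBall t₀ r, k t = 0 := by
  by_cases hk0 : k t₀ = 0
  · exact ⟨t₀, mem_closedBall_self hr.le, hk0⟩
  have hsub : closedBall t₀ r ⊆ ball t₀ R := closedBall_subset_ball hrR
  have h1 : DiffContOnCl ℂ k (ball t₀ r) := by
    refine ⟨hk.mono (ball_subset_ball hrR.le), ?_⟩
    rw [closure_ball _ hr.ne']
    exact hk.continuousOn.mono hsub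
  have h2 : ∀ t ∈ sphere t₀ r, 2 * ε / 3 ≤ ‖k t - k t₀‖ := by
    intro t ht
    have := norm_sub_norm_le (k t) (k t₀)
    linarith [hs t ht]
  have h3 : ∃ᶠ t in 𝓝 t₀, k t ≠ k t₀ := by
    intro hcon
    have hev : k =ᶠ[𝓝 t₀] fun _ => k t₀ := by
      filter_upwards [hcon] with t ht
      exact not_not.1 ht
    have ha : AnalyticOnNhd ℂ k (ball t₀ R) := hk.analyticOnNhd isOpen_ball
    have heq := ha.eqOn_of_preconnected_of_eventuallyEq (g := fun _ => k t₀)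
      (fun _ _ => analyticAt_const) (convex_ball _ _).isPreconnected
      (mem_ball_self (hr.trans hrR)) hev
    obtain ⟨t, ht⟩ : (sphere t₀ r).Nonempty := NormedSpace.sphere_nonempty.2 hr.le
    have := h2 t ht
    rw [heq (hsub (sphere_subset_closedBall ht))] at this
    simp only [sub_self, norm_zero] at this
    linarith [norm_nonneg (k t₀)]
  have := h1.ball_subset_image_closedBall hr h2 h3
  obtain ⟨t, ht, ht'⟩ := this (show (0 : ℂ) ∈ ball (k t₀) (2 * ε / 3 / 2) by
    rw [mem_ball, dist_eq_norm, zero_sub, norm_neg]; linarith)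
  exact ⟨t, ht, ht'⟩

end partA

section partB
open Set Metric Filter Topology
set_option maxHeartbeats 1000000 in
theorem deriv_ne_zero_of_injOn {f : ℂ → ℂ} {s : Set ℂ} (hs : IsOpen s)
    (hf : DifferentiableOn ℂ f s) (hinj : InjOn f s) {a : ℂ} (ha : a ∈ s) : deriv f a ≠ 0 := by
  intro h0
  obtain ⟨R, hR, hRs⟩ := Metric.isOpen_iff.1 hs a ha
  have hfR : DifferentiableOn ℂ f (ball a R) := hf.mono hRs
  have hanD : AnalyticAt ℂ (deriv f) a := ((hf.analyticAt (hs.mem_nhds ha)).deriv)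
  have hD : ∀ᶠ y in 𝓝[≠] a, deriv f y ≠ 0 := by
    rcases hanD.eventually_eq_zero_or_eventually_ne_zero with h | h
    · exfalso
      obtain ⟨δ, hδ, hδ'⟩ := Metric.eventually_nhds_iff_ball.1
        (h.and (isOpen_ball.mem_nhds (mem_ball_self hR)))
      have hconst : ∀ y ∈ ball a δ, f y = f a := fun y hy =>
        (convex_ball a δ).is_const_of_fderivWithin_eq_zero (𝕜 := ℂ)
          (hfR.mono fun x hx => (hδ' x hx).2) (fun x hx => by
            rw [fderivWithin_of_isOpen isOpen_ball hx]
            ext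
            simpa using (hδ' x hx).1) hy (mem_ball_self hδ)
      have hy : a + (δ / 2 : ℝ) ∈ ball a δ := by
        rw [mem_ball, dist_eq_norm, add_sub_cancel_left, Complex.norm_real, Real.norm_eq_abs,
          abs_of_pos (by positivity)]
        linarith
      have := hinj (hRs (hδ' _ hy).2) ha (hconst _ hy)
      simp at this
      exact hδ.ne' this
    · exact h
  -- `dslope f a` is nonzero off `a`
  set r := R / 2 with hr
  have hrpos : 0 < r := by positivity
  have hds : ∀ y ∈ ball a R, DifferentiableOn ℂ (dslope f y) (ball a R) := fun y hy =>
    (Complex.differentiableOn_dslope (isOpen_ball.mem_nhds hy)).2 hfR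
  have hne : ∀ t ∈ sphere a r, ∀ y ∈ ball a r, dslope f y t ≠ 0 := by
    intro t ht y hy hcon
    have hty : t ≠ y := by
      rintro rfl
      rw [mem_sphere] at ht; rw [mem_ball] at hy; linarith
    rw [dslope_of_ne _ hty, slope_def_field, div_eq_zero_iff] at hcon
    rcases hcon with h | h
    · refine hty (hinj (hRs ?_) (hRs ?_) (sub_eq_zero.1 h))
      · rw [mem_ball, mem_sphere.1 ht]; linarith
      · exact ball_subset_ball (by linarith) hy
    · exact hty (sub_eq_zero.1 h)
  have hcf : ContinuousOn f (sphere a r) := hfR.continuousOn.mono fun t ht => by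
    rw [mem_ball, mem_sphere.1 ht]; linarith
  obtain ⟨ε, hε, hε'⟩ : ∃ ε > 0, ∀ t ∈ sphere a r, ∀ y ∈ closedBall a (r/2), ε ≤ ‖dslope f y t‖ := by
    have hK : IsCompact (sphere a r ×ˢ closedBall a (r/2)) :=
      (isCompact_sphere a r).prod (isCompact_closedBall _ _)
    have hcont : ContinuousOn (fun p : ℂ × ℂ => ‖dslope f p.2 p.1‖)
        (sphere a r ×ˢ closedBall a (r/2)) := by
      have hne' : ∀ p ∈ sphere a r ×ˢ closedBall a (r/2), p.1 ≠ p.2 := by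
        rintro ⟨t, y⟩ ⟨h1, h2⟩ (h3 : t = y)
        subst h3
        simp only [mem_sphere, mem_closedBall] at h1 h2
        linarith
      have : ContinuousOn (fun p : ℂ × ℂ => ‖(f p.1 - f p.2) / (p.1 - p.2)‖)
          (sphere a r ×ˢ closedBall a (r/2)) := by
        refine ContinuousOn.norm (ContinuousOn.div (ContinuousOn.sub ?_ ?_) (by fun_prop) ?_)
        · exact hcf.comp continuousOn_fst fun p hp => hp.1
        · exact hfR.continuousOn.comp continuousOn_snd fun p hp =>
            closedBall_subset_ball (by linarith) hp.2
        · exact fun p hp => sub_ne_zero.2 (hne' p hp)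
      refine this.congr fun p hp => ?_
      simp only
      rw [dslope_of_ne _ (hne' p hp), slope_def_field]
    have hnonempty : (sphere a r ×ˢ closedBall a (r/2)).Nonempty :=
      (NormedSpace.sphere_nonempty.2 hrpos.le).prod ⟨a, mem_closedBall_self (by positivity)⟩
    obtain ⟨p, hp, hmin⟩ := hK.exists_isMinOn hnonempty hcont
    refine ⟨_, norm_pos_iff.2 (hne p.1 hp.1 p.2 (closedBall_subset_ball (by linarith) hp.2)), ?_⟩
    intro t ht y hy
    exact isMinOn_iff.1 hmin (t, y) (mk_mem_prod ht hy)
  -- choose y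
  have hlim : Tendsto (fun y => dslope f y a) (𝓝[≠] a) (𝓝 0) := by
    have hd : HasDerivAt f 0 a := by
      rw [← h0]; exact (hfR.differentiableAt (isOpen_ball.mem_nhds (mem_ball_self hR))).hasDerivAt
    rw [hasDerivAt_iff_tendsto_slope] at hd
    refine hd.congr' ?_
    filter_upwards [self_mem_nhdsWithin] with y hy
    rw [dslope_of_ne _ (Ne.symm hy), slope_comm]
  have hsm : ∀ᶠ y in 𝓝[≠] a, ‖dslope f y a‖ < ε / 3 := by
    have := hlim.norm
    rw [norm_zero] at this
    exact this.eventually_lt_const (by positivity)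
  have hnear : ∀ᶠ y in 𝓝[≠] a, y ∈ closedBall a (r/2) :=
    mem_nhdsWithin_of_mem_nhds (closedBall_mem_nhds _ (by positivity))
  obtain ⟨y, hy1, hy2, hy3⟩ := (hD.and (hsm.and hnear)).exists
  have hyR : y ∈ ball a R := closedBall_subset_ball (by linarith) hy3
  obtain ⟨t, ht, ht'⟩ := exists_zero_of_sphere hrpos (by linarith) (hds y hyR)
    (fun t ht => hε' t ht y hy3) hy2
  by_cases hty : t = y
  · subst hty
    rw [dslope_same] at ht'
    exact hy1 ht'
  · rw [dslope_of_ne _ hty, slope_def_field, div_eq_zero_iff] at ht'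
    rcases ht' with h | h
    · exact hty (hinj (hRs (closedBall_subset_ball (by linarith) ht)) (hRs hyR) (sub_eq_zero.1 h))
    · exact hty (sub_eq_zero.1 h)

end partB

section partC
open Set Metric Filter Topology

/-- iterated partial derivative in the second variable -/
noncomputable def ptl (H : ℂ × ℂ → ℂ) : ℕ → ℂ × ℂ → ℂ
  | 0 => H
  | k + 1 => fun p => fderiv ℂ (ptl H k) p (0, 1)

theorem ptl_diff {H : ℂ × ℂ → ℂ} {P : Set (ℂ × ℂ)} (hP : IsOpen P) (hH : DifferentiableOn ℂ H P)
    (k : ℕ) : DifferentiableOn ℂ (ptl H k) P := by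
  induction k with
  | zero => exact hH
  | succ k ih => exact sv_fderiv_apply hP ih (0, 1)

theorem ptl_eq {H : ℂ × ℂ → ℂ} {P : Set (ℂ × ℂ)} (hP : IsOpen P) (hH : DifferentiableOn ℂ H P)
    (k : ℕ) : ∀ s t : ℂ, (s, t) ∈ P → iteratedDeriv k (fun t => H (s, t)) t = ptl H k (s, t) := by
  induction k with
  | zero => intro s t _; simp [ptl]
  | succ k ih =>
    intro s t hst
    rw [iteratedDeriv_succ]
    have hc : Continuous fun t' : ℂ => (s, t') := by fun_prop
    have hev : iteratedDeriv k (fun t => H (s, t)) =ᶠ[𝓝 t] fun t' => ptl H k (s, t') := by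
      filter_upwards [(hP.preimage hc).mem_nhds hst] with t' ht'
      exact ih s t' ht'
    rw [hev.deriv_eq]
    have h1 : HasFDerivAt (ptl H k) (fderiv ℂ (ptl H k) (s, t)) (s, t) :=
      ((ptl_diff hP hH k).differentiableAt (hP.mem_nhds hst)).hasFDerivAt
    have h2 : HasDerivAt (fun t' : ℂ => (s, t')) ((0 : ℂ), (1 : ℂ)) t :=
      (hasDerivAt_const t s).prodMk (hasDerivAt_id t)
    exact (h1.comp_hasDerivAt t h2).deriv

theorem two_dim {F : Type*} [NormedAddCommGroup F] [NormedSpace ℂ F]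
    {H : ℂ × ℂ → ℂ} {G : ℂ × ℂ → F} {P : Set (ℂ × ℂ)} (hP : IsOpen P)
    (hH : DifferentiableOn ℂ H P) (hG : DifferentiableOn ℂ G P) (hinj : InjOn G P)
    (hHG : ∀ p ∈ P, H p = 0 → fderiv ℂ G p = 0) {s₀ t₀ : ℂ} (h0 : (s₀, t₀) ∈ P)
    (hH0 : H (s₀, t₀) = 0) (hne : ¬ ∀ᶠ t in 𝓝 t₀, H (s₀, t) = 0) : False := by
  classical
  have hex : ∃ j, ∃ p ∈ P, H p = 0 ∧ ptl H j p ≠ 0 := by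
    by_contra! hcon
    apply hne
    have hc : Continuous fun t' : ℂ => (s₀, t') := by fun_prop
    obtain ⟨R, hR, hRs⟩ := Metric.isOpen_iff.1 (hP.preimage hc) t₀ h0
    filter_upwards [ball_mem_nhds t₀ hR] with t ht
    have hd : DifferentiableOn ℂ (fun t => H (s₀, t)) (ball t₀ R) :=
      hH.comp (by fun_prop) hRs
    have := Complex.hasSum_taylorSeries_on_ball hd ht
    refine this.unique ?_
    convert hasSum_zero with k
    rw [ptl_eq hP hH k s₀ t₀ h0, hcon k _ h0 hH0]
    simp
  obtain ⟨⟨s₁, t₁⟩, hp, hHp, hjp⟩ := Nat.find_spec hex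
  have hmin : ∀ i < Nat.find hex, ∀ p ∈ P, H p = 0 → ptl H i p = 0 := by
    intro i hi p hpP hp0
    by_contra hcon
    exact Nat.find_min hex hi ⟨p, hpP, hp0, hcon⟩
  obtain ⟨k, hk⟩ : ∃ k, Nat.find hex = k + 1 := by
    refine Nat.exists_eq_succ_of_ne_zero fun h => hjp ?_
    rw [h]; exact hHp
  rw [hk] at hjp hmin
  set q := ptl H k with hq
  have hqd : DifferentiableOn ℂ q P := ptl_diff hP hH k
  have hq0 : ∀ p ∈ P, H p = 0 → q p = 0 := hmin k (Nat.lt_succ_self k)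
  have hq1 : fderiv ℂ q (s₁, t₁) (0, 1) ≠ 0 := hjp
  have hcq : ContDiffAt ℂ 1 q (s₁, t₁) := sv_contDiffAt hP hqd hp
  have hinv : (fderiv ℂ q (s₁, t₁) ∘L .inr ℂ ℂ ℂ).IsInvertible := by
    refine ⟨ContinuousLinearEquiv.unitsEquivAut ℂ (Units.mk0 _ hq1), ?_⟩
    ext
    simp
  set τ := hcq.implicitFunction one_ne_zero hinv with hτ
  have hτ0 : τ s₁ = t₁ := hcq.implicitFunction_apply_self one_ne_zero hinv
  have hτd : ContDiffAt ℂ 1 τ s₁ := hcq.contDiffAt_implicitFunction one_ne_zero hinv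
  have hτi := hcq.eventually_apply_eq_iff_implicitFunction one_ne_zero hinv
  rw [← hτ, hq0 _ hp hHp] at hτi
  -- isolated zero
  have hc : Continuous fun t' : ℂ => (s₁, t') := by fun_prop
  obtain ⟨R, hR, hRs⟩ := Metric.isOpen_iff.1 (hP.preimage hc) t₁ hp
  have hd : DifferentiableOn ℂ (fun t => H (s₁, t)) (ball t₁ R) := hH.comp (by fun_prop) hRs
  have hiso : ∀ᶠ t in 𝓝[≠] t₁, H (s₁, t) ≠ 0 := by
    rcases (hd.analyticAt (ball_mem_nhds _ hR)).eventually_eq_zero_or_eventually_ne_zero with h | h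
    · exfalso
      apply hjp
      rw [← ptl_eq hP hH (k + 1) s₁ t₁ hp]
      have : (fun t => H (s₁, t)) =ᶠ[𝓝 t₁] fun _ => 0 := h
      rw [this.iteratedDeriv_eq]
      simp
    · exact h
  rw [eventually_nhdsWithin_iff] at hiso
  -- box
  have hbox : ∀ᶠ p in 𝓝 (s₁, t₁), p ∈ P ∧ (q p = 0 ↔ τ p.1 = p.2) :=
    Filter.Eventually.and (hP.eventually_mem hp) hτi
  rw [nhds_prod_eq] at hbox
  obtain ⟨pa, hpa, pb, hpb, hab⟩ := eventually_prod_iff.1 hbox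
  obtain ⟨R', hR', hRR⟩ := Metric.eventually_nhds_iff_ball.1 (hpb.and hiso)
  set r := R' / 2 with hr
  have hr0 : 0 < r := by positivity
  have hsph : ∀ t ∈ sphere t₁ r, t ∈ ball t₁ R' := fun t ht => by
    rw [mem_ball, mem_sphere.1 ht]; linarith
  have hPs : ∀ t ∈ ball t₁ R', (s₁, t) ∈ P := fun t ht => (hab hpa.self_of_nhds (hRR t ht).1).1
  obtain ⟨ε, hε, hε'⟩ : ∃ ε > 0, ∀ t ∈ sphere t₁ r, ε < ‖H (s₁, t)‖ := by
    have hcon : ContinuousOn (fun t => ‖H (s₁, t)‖) (sphere t₁ r) :=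
      (hH.continuousOn.comp (by fun_prop) (fun t ht => hPs t (hsph t ht))).norm
    obtain ⟨t, ht, hmin'⟩ := (isCompact_sphere t₁ r).exists_isMinOn
      (NormedSpace.sphere_nonempty.2 hr0.le) hcon
    have hpos : 0 < ‖H (s₁, t)‖ := by
      refine norm_pos_iff.2 ((hRR t (hsph t ht)).2 ?_)
      rintro rfl
      rw [mem_sphere, dist_self] at ht
      exact hr0.ne ht
    refine ⟨‖H (s₁, t)‖ / 2, by positivity, fun t' ht' => ?_⟩
    have := isMinOn_iff.1 hmin' t' ht'
    linarith
  have hev1 : ∀ᶠ s in 𝓝 s₁, ∀ t ∈ sphere t₁ r, ε < ‖H (s, t)‖ := by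
    refine (isCompact_sphere t₁ r).eventually_forall_of_forall_eventually fun t ht => ?_
    have : ContinuousAt H (s₁, t) := (hH.differentiableAt (hP.mem_nhds (hPs t (hsph t ht)))).continuousAt
    exact this.norm.eventually_const_lt (hε' t ht)
  have hev2 : ∀ᶠ s in 𝓝 s₁, ‖H (s, t₁)‖ < ε / 3 := by
    have : ContinuousAt H (s₁, t₁) := (hH.differentiableAt (hP.mem_nhds hp)).continuousAt
    have h2 : ContinuousAt (fun s => H (s, t₁)) s₁ :=
      ContinuousAt.comp (f := fun s : ℂ => (s, t₁)) this (by fun_prop)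
    refine h2.norm.eventually_lt_const ?_
    simp only
    rw [hHp, norm_zero]; positivity
  have hev3 : ∀ᶠ s in 𝓝 s₁, DifferentiableAt ℂ τ s := by
    filter_upwards [hτd.eventually (by simp)] with s hs
    exact hs.differentiableAt (by simp)
  have hall : ∀ᶠ s in 𝓝 s₁, (s, τ s) ∈ P ∧ H (s, τ s) = 0 ∧ DifferentiableAt ℂ τ s := by
    filter_upwards [hev1, hev2, hev3, hpa] with s h1 h2 h3 h4
    have hdiff : DifferentiableOn ℂ (fun t => H (s, t)) (ball t₁ R') :=
      hH.comp (by fun_prop) fun t ht => (hab h4 (hRR t ht).1).1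
    obtain ⟨t, ht, ht0⟩ := exists_zero_of_sphere hr0 (by linarith) hdiff
      (fun t ht => (h1 t ht).le) h2
    have hab' := hab h4 (hRR t (closedBall_subset_ball (by linarith) ht)).1
    have hτt : τ s = t := hab'.2.1 (hq0 _ hab'.1 ht0)
    rw [hτt]
    exact ⟨hab'.1, ht0, h3⟩
  obtain ⟨δ, hδ, hδ'⟩ := Metric.eventually_nhds_iff_ball.1 hall
  have hder : ∀ s ∈ ball s₁ δ, HasFDerivAt (fun s => G (s, τ s)) (0 : ℂ →L[ℂ] F) s := by
    intro s hs
    obtain ⟨h1, h2, h3⟩ := hδ' s hs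
    have hg : HasFDerivAt G (0 : ℂ × ℂ →L[ℂ] F) (s, τ s) := by
      rw [← hHG _ h1 h2]; exact (hG.differentiableAt (hP.mem_nhds h1)).hasFDerivAt
    have := hg.comp (f := fun s => (s, τ s)) s ((hasFDerivAt_id s).prodMk h3.hasFDerivAt)
    rw [ContinuousLinearMap.zero_comp] at this
    exact this
  have hs2 : s₁ + (δ / 2 : ℝ) ∈ ball s₁ δ := by
    rw [mem_ball, dist_eq_norm, add_sub_cancel_left, Complex.norm_real, Real.norm_eq_abs,
      abs_of_pos (by positivity)]
    linarith
  have hconst := (convex_ball s₁ δ).is_const_of_fderivWithin_eq_zero (𝕜 := ℂ)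
    (f := fun s => G (s, τ s))
    (fun s hs => (hder s hs).differentiableAt.differentiableWithinAt)
    (fun s hs => by
      rw [fderivWithin_of_isOpen isOpen_ball hs]; exact (hder s hs).fderiv)
    hs2 (mem_ball_self hδ)
  have := hinj (hδ' _ hs2).1 (hδ' _ (mem_ball_self hδ)).1 hconst
  have h5 := congrArg Prod.fst this
  simp at h5
  exact hδ.ne' h5

end partC

section partD
open Set Metric Filter Topology

/-- local holomorphic inverse -/
theorem loc_inv {E F : Type} [NormedAddCommGroup E] [NormedSpace ℂ E] [FiniteDimensional ℂ E]
    [NormedAddCommGroup F] [NormedSpace ℂ F] [FiniteDimensional ℂ F] {f : E → F} {s : Set E} {a : E}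
    (hs : IsOpen s) (ha : a ∈ s) (hf : DifferentiableOn ℂ f s) (A : E ≃L[ℂ] F)
    (hA : HasFDerivAt f (A : E →L[ℂ] F) a) :
    ∃ Ψ : F → E, Ψ (f a) = a ∧ HasFDerivAt Ψ (A.symm : F →L[ℂ] E) (f a) ∧
      ∀ᶠ y in 𝓝 (f a), DifferentiableAt ℂ Ψ y ∧ Ψ y ∈ s ∧ f (Ψ y) = y := by
  have : CompleteSpace E := FiniteDimensional.complete ℂ E
  have hc := sv_contDiffAt hs hf ha
  have hst := hc.hasStrictFDerivAt' hA one_ne_zero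
  have h1 : hst.localInverse f A a (f a) = a := hst.localInverse_apply_image
  refine ⟨hst.localInverse f A a, h1, hst.to_localInverse.hasFDerivAt, ?_⟩
  have hd : ContDiffAt ℂ 1 (hst.localInverse f A a) (f a) := hc.to_localInverse hA one_ne_zero
  have hd' : ∀ᶠ y in 𝓝 (f a), DifferentiableAt ℂ (hst.localInverse f A a) y := by
    filter_upwards [hd.eventually (by simp)] with s hs
    exact hs.differentiableAt (by simp)
  have hs' : ∀ᶠ y in 𝓝 (f a), hst.localInverse f A a y ∈ s := by
    apply hd.continuousAt.eventually_mem
    rw [h1]; exact hs.mem_nhds ha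
  filter_upwards [hd', hs', hst.eventually_right_inverse] with y h1 h2 h3
  exact ⟨h1, h2, h3⟩

theorem finrank_ker_aux {E : Type} [AddCommGroup E] [Module ℂ E] [FiniteDimensional ℂ E]
    (f : E →ₗ[ℂ] ℂ) (hf : f ≠ 0) {n : ℕ} (h : Module.finrank ℂ E = n + 1) :
    Module.finrank ℂ (LinearMap.ker f) = n := by
  have h1 := f.finrank_range_add_finrank_ker
  have h2 : LinearMap.range f = ⊤ := LinearMap.range_eq_top.2 (LinearMap.surjective hf)
  rw [h2, finrank_top, Module.finrank_self, h] at h1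
  omega

def OsgoodP (n : ℕ) : Prop := ∀ (E F : Type) [NormedAddCommGroup E] [NormedSpace ℂ E]
  [FiniteDimensional ℂ E] [NormedAddCommGroup F] [NormedSpace ℂ F] [FiniteDimensional ℂ F],
  Module.finrank ℂ E = n → Module.finrank ℂ F = n → ∀ (f : E → F) (s : Set E) (a : E), IsOpen s →
    a ∈ s → DifferentiableOn ℂ f s → InjOn f s → Function.Injective (fderiv ℂ f a)

theorem osgood_step1 {n : ℕ} (ih : OsgoodP n) {E F : Type} [NormedAddCommGroup E] [NormedSpace ℂ E]
    [FiniteDimensional ℂ E] [NormedAddCommGroup F] [NormedSpace ℂ F] [FiniteDimensional ℂ F]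
    (hE : Module.finrank ℂ E = n + 1) (hF : Module.finrank ℂ F = n + 1) {f : E → F} {s : Set E}
    {a : E} (hs : IsOpen s) (ha : a ∈ s) (hf : DifferentiableOn ℂ f s) (hinj : InjOn f s)
    (hne : fderiv ℂ f a ≠ 0) : Function.Injective (fderiv ℂ f a) := by
  have hfa : HasFDerivAt f (fderiv ℂ f a) a := (hf.differentiableAt (hs.mem_nhds ha)).hasFDerivAt
  set A := fderiv ℂ f a with hA
  obtain ⟨v, hv⟩ : ∃ v, A v ≠ 0 := by
    by_contra! h
    exact hne (by ext x; simpa using h x)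
  obtain ⟨ℓ, hℓ⟩ := SeparatingDual.exists_eq_one (R := ℂ) hv
  set B : E →L[ℂ] ℂ := ℓ.comp A with hB
  have hBv : B v = 1 := hℓ
  set K := LinearMap.ker (B : E →ₗ[ℂ] ℂ) with hK
  set M := LinearMap.ker (ℓ : F →ₗ[ℂ] ℂ) with hM
  have hKr : Module.finrank ℂ K = n := finrank_ker_aux _ (fun h => by
    have : (B : E →ₗ[ℂ] ℂ) v = 0 := by rw [h]; rfl
    rw [ContinuousLinearMap.coe_coe, hBv] at this
    exact one_ne_zero this) hE
  have hMr : Module.finrank ℂ M = n := finrank_ker_aux _ (fun h => by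
    have : (ℓ : F →ₗ[ℂ] ℂ) (A v) = 0 := by rw [h]; rfl
    rw [ContinuousLinearMap.coe_coe, hℓ] at this
    exact one_ne_zero this) hF
  set π : F →L[ℂ] M := (ContinuousLinearMap.id ℂ F - ℓ.smulRight (A v)).codRestrict M
    (fun x => by
      rw [hM, LinearMap.mem_ker]
      simp [hℓ]) with hπ
  have hπM : ∀ y, ℓ y = 0 → (π y : F) = y := by
    intro y hy
    simp [hπ, hy]
  set Φ : E → E := fun x => x + (ℓ (f x - f a) - B (x - a)) • v with hΦ
  have hΦa : Φ a = a := by simp [hΦ]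
  have hΦd : DifferentiableOn ℂ Φ s := by
    apply DifferentiableOn.add differentiableOn_id
    apply DifferentiableOn.smul_const
    exact (ℓ.differentiable.comp_differentiableOn (hf.sub_const _)).sub
      (B.differentiable.comp_differentiableOn (differentiableOn_id.sub_const _))
  have hΦ' : HasFDerivAt Φ ((ContinuousLinearEquiv.refl ℂ E : E ≃L[ℂ] E) : E →L[ℂ] E) a := by
    have h1 : HasFDerivAt Φ _ a := (hasFDerivAt_id (𝕜 := ℂ) a).add
      (((ℓ.hasFDerivAt.comp a (hfa.sub_const (f a))).sub
        (B.hasFDerivAt.comp a ((hasFDerivAt_id a).sub_const a))).smul_const v)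
    have h2 : ((ContinuousLinearEquiv.refl ℂ E : E ≃L[ℂ] E) : E →L[ℂ] E) =
        ContinuousLinearMap.id ℂ E +
          (ℓ.comp A - B.comp (ContinuousLinearMap.id ℂ E)).smulRight v := by
      ext x
      simp [hB]
    rw [h2]
    exact h1
  have hBΦ : ∀ x, B (Φ x - a) = ℓ (f x - f a) := by
    intro x
    simp only [hΦ, map_sub, map_add, map_smul, hBv, smul_eq_mul]
    ring
  obtain ⟨Ψ, hΨa, hΨd, hΨ⟩ := loc_inv hs ha hΦd _ hΦ'
  rw [hΦa] at hΨa hΨd hΨ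
  obtain ⟨ε, hε, hball⟩ := Metric.eventually_nhds_iff_ball.1 hΨ
  have hmem : ∀ k : K, k ∈ ball (0 : K) ε → a + (k : E) ∈ ball a ε := by
    intro k hk
    simpa using hk
  set q : K → M := fun k => π (f (Ψ (a + k)) - f a) with hq
  have hq' : HasFDerivAt q (π.comp (A.comp K.subtypeL)) 0 := by
    have h0 : HasFDerivAt (fun k : K => a + (k : E)) K.subtypeL 0 := by
      simpa using (K.subtypeL.hasFDerivAt (x := 0)).const_add a
    have h1 : HasFDerivAt Ψ (ContinuousLinearMap.id ℂ E) (a + ((0 : K) : E)) := by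
      simpa using hΨd
    have h2 := h1.comp (0 : K) h0
    have h3 : HasFDerivAt f A ((Ψ ∘ fun k : K => a + (k : E)) 0) := by
      simpa [hΨa] using hfa
    have h4 := h3.comp (0 : K) h2
    exact π.hasFDerivAt.comp (0 : K) (h4.sub_const (f a))
  have hker : ∀ k ∈ ball (0 : K) ε, (π (f (Ψ (a + k)) - f a) : F) = f (Ψ (a + k)) - f a := by
    intro k hk
    apply hπM
    rw [← hBΦ, (hball _ (hmem k hk)).2.2, add_sub_cancel_left]
    exact k.2
  have hinjq := ih K M hKr hMr q (ball 0 ε) 0 isOpen_ball (mem_ball_self hε) ?_ ?_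
  · rw [hq'.fderiv] at hinjq
    rw [injective_iff_map_eq_zero]
    intro x hx
    have hxK : x ∈ K := by
      rw [hK, LinearMap.mem_ker]
      simp [hB, hx]
    have := @hinjq ⟨x, hxK⟩ 0 (by simp [hx])
    simpa using this
  · intro k hk
    apply DifferentiableAt.differentiableWithinAt
    obtain ⟨h1, h2, h3⟩ := hball _ (hmem k hk)
    refine π.differentiableAt.comp k (DifferentiableAt.sub_const ?_ _)
    refine DifferentiableAt.comp (g := f) k (hf.differentiableAt (hs.mem_nhds h2)) ?_
    refine DifferentiableAt.comp (g := Ψ) k h1 ?_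
    exact (differentiableAt_const a).add K.subtypeL.differentiableAt
  · intro k hk k' hk' hkk
    have h1 := congrArg (fun m : M => (m : F)) hkk
    simp only [hq] at h1
    rw [hker k hk, hker k' hk', sub_left_inj] at h1
    obtain ⟨-, h2, h3⟩ := hball _ (hmem k hk)
    obtain ⟨-, h2', h3'⟩ := hball _ (hmem k' hk')
    have h4 := hinj h2 h2' h1
    rw [h4, h3'] at h3
    have := add_left_cancel h3
    exact Subtype.ext this.symm

theorem osgood_dim1 {E F : Type} [NormedAddCommGroup E] [NormedSpace ℂ E]
    [FiniteDimensional ℂ E] [NormedAddCommGroup F] [NormedSpace ℂ F] [FiniteDimensional ℂ F]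
    (hE : Module.finrank ℂ E = 1) (hF : Module.finrank ℂ F = 1) {f : E → F} {s : Set E}
    {a : E} (hs : IsOpen s) (ha : a ∈ s) (hf : DifferentiableOn ℂ f s) (hinj : InjOn f s)
    (h0 : fderiv ℂ f a = 0) : False := by
  have : Nontrivial E := Module.nontrivial_of_finrank_pos (R := ℂ) (by omega)
  have : Nontrivial F := Module.nontrivial_of_finrank_pos (R := ℂ) (by omega)
  obtain ⟨v, hv⟩ := exists_ne (0 : E)
  obtain ⟨y, hy⟩ := exists_ne (0 : F)
  obtain ⟨ℓ, hℓ⟩ := SeparatingDual.exists_eq_one (R := ℂ) hy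
  have hℓi : Function.Injective ℓ := by
    have h1 : Function.Surjective (ℓ : F →ₗ[ℂ] ℂ) := LinearMap.surjective (fun h => by
      have : (ℓ : F →ₗ[ℂ] ℂ) y = 0 := by rw [h]; rfl
      rw [ContinuousLinearMap.coe_coe, hℓ] at this
      exact one_ne_zero this)
    exact (LinearMap.injective_iff_surjective_of_finrank_eq_finrank (by simp [hF])).2 h1
  set L : ℂ → E := fun t => a + t • v with hL
  have hLd : Differentiable ℂ L := by fun_prop
  have hL0 : L 0 = a := by simp [hL]
  have hd : DifferentiableOn ℂ (fun t => ℓ (f (L t))) (L ⁻¹' s) :=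
    ℓ.differentiable.comp_differentiableOn
      (hf.comp hLd.differentiableOn (fun t ht => ht))
  refine deriv_ne_zero_of_injOn (hs.preimage hLd.continuous) hd ?_ (a := 0) (by simpa [hL] using ha) ?_
  · intro t ht t' ht' htt
    have h1 := hinj ht ht' (hℓi htt)
    have h2 := add_left_cancel h1
    exact smul_left_injective ℂ hv h2
  · have h1 : HasFDerivAt f (0 : E →L[ℂ] F) (L 0) := by
      rw [hL0, ← h0]; exact (hf.differentiableAt (hs.mem_nhds ha)).hasFDerivAt
    have h2 := ℓ.hasFDerivAt.comp_hasDerivAt (0 : ℂ) (h1.comp_hasDerivAt (0 : ℂ) (hLd 0).hasDerivAt)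
    have h3 := h2.deriv
    simpa [Function.comp_def] using h3

theorem diffOn_prod {E ι : Type} [NormedAddCommGroup E] [NormedSpace ℂ E] (u : Finset ι)
    {φ : ι → E → ℂ} {s : Set E} (h : ∀ i, DifferentiableOn ℂ (φ i) s) :
    DifferentiableOn ℂ (fun x => ∏ i ∈ u, φ i x) s := by
  classical
  induction u using Finset.induction_on with
  | empty => simpa using differentiableOn_const (1 : ℂ)
  | insert i u hi ih =>
    simp only [Finset.prod_insert hi]
    exact (h i).mul ih

theorem osgood_dim2 {n : ℕ} {E F : Type} [NormedAddCommGroup E] [NormedSpace ℂ E]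
    [FiniteDimensional ℂ E] [NormedAddCommGroup F] [NormedSpace ℂ F] [FiniteDimensional ℂ F]
    (hE : Module.finrank ℂ E = n + 2) (hF : Module.finrank ℂ F = n + 2) {f : E → F} {s : Set E}
    {a : E} (hs : IsOpen s) (ha : a ∈ s) (hf : DifferentiableOn ℂ f s) (hinj : InjOn f s)
    (hstep : ∀ x ∈ s, fderiv ℂ f x ≠ 0 → Function.Injective (fderiv ℂ f x))
    (h0 : fderiv ℂ f a = 0) : False := by
  have : Nontrivial E := Module.nontrivial_of_finrank_pos (R := ℂ) (by omega)
  have e : F ≃L[ℂ] E := ContinuousLinearEquiv.ofFinrankEq (by rw [hE, hF])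
  set b := Module.finBasisOfFinrankEq ℂ E hE with hb
  set h : E → ℂ := fun x => Matrix.det (Matrix.of fun i j => b.coord i (e (fderiv ℂ f x (b j)))) with hh
  have hdet : ∀ x, h x = LinearMap.det ((e.toLinearEquiv : F →ₗ[ℂ] E) ∘ₗ (fderiv ℂ f x : E →ₗ[ℂ] F)) := by
    intro x
    rw [← LinearMap.det_toMatrix b]
    simp only [hh]
    congr 1
    ext i j
    simp [LinearMap.toMatrix_apply]
  have hzero : ∀ x ∈ s, h x = 0 → fderiv ℂ f x = 0 := by
    intro x hx hx0
    by_contra hne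
    have hi := hstep x hx hne
    rw [hdet] at hx0
    have h1 := LinearMap.bot_lt_ker_of_det_eq_zero hx0
    have h2 : LinearMap.ker ((e.toLinearEquiv : F →ₗ[ℂ] E) ∘ₗ (fderiv ℂ f x : E →ₗ[ℂ] F)) = ⊥ := by
      rw [LinearMap.ker_eq_bot]
      exact e.injective.comp hi
    rw [h2] at h1
    exact lt_irrefl _ h1
  have hha : h a = 0 := by
    have : (Matrix.of fun i j => b.coord i (e (fderiv ℂ f a (b j)))) = 0 := by
      ext i j; simp [h0]
    simp only [hh]
    rw [this, Matrix.det_zero]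
  have hhd : DifferentiableOn ℂ h s := by
    simp only [hh, Matrix.det_apply, Matrix.of_apply]
    refine DifferentiableOn.fun_sum fun σ _ => ?_
    refine DifferentiableOn.const_smul ?_ _
    refine diffOn_prod _ fun i => ?_
    have h1 := sv_fderiv_apply hs hf (b i)
    have h2 := (((LinearMap.toContinuousLinearMap (b.coord (σ i))).comp
      (e : F →L[ℂ] E)).differentiable).comp_differentiableOn h1
    exact h2
  obtain ⟨R, hR, hRs⟩ := Metric.isOpen_iff.1 hs a ha
  obtain ⟨c, hc, hhc⟩ : ∃ c ∈ ball a R, h c ≠ 0 := by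
    by_contra! hall
    have hconst : ∀ x ∈ ball a R, f x = f a := fun x hx =>
      (convex_ball a R).is_const_of_fderivWithin_eq_zero (𝕜 := ℂ) (hf.mono hRs) (fun y hy => by
        rw [fderivWithin_of_isOpen isOpen_ball hy]
        exact hzero y (hRs hy) (hall y hy)) hx (mem_ball_self hR)
    obtain ⟨u, hu⟩ := exists_ne (0 : E)
    obtain ⟨r, hr, hr'⟩ := Metric.eventually_nhds_iff_ball.1
      (((continuous_const.add (continuous_id.smul continuous_const)).tendsto' (0 : ℂ) a
        (by simp : a + (0 : ℂ) • u = a)).eventually (ball_mem_nhds a hR))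
    have hm : ((r / 2 : ℝ) : ℂ) ∈ ball (0 : ℂ) r := by
      rw [mem_ball_zero_iff, Complex.norm_real, Real.norm_eq_abs, abs_of_pos (by positivity)]
      linarith
    have h1 := hr' _ hm
    have h2 := hinj (hRs h1) ha (hconst _ h1)
    have h3 : ((r / 2 : ℝ) : ℂ) • u = 0 := by simpa using h2
    rcases smul_eq_zero.1 h3 with h4 | h4
    · rw [Complex.ofReal_eq_zero] at h4
      linarith
    · exact hu h4
  set v := c - a with hv
  have hv0 : v ≠ 0 := by
    intro hv0
    rw [hv, sub_eq_zero] at hv0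
    rw [hv0] at hhc
    exact hhc hha
  obtain ⟨w, hw⟩ : ∃ w, w ∉ Submodule.span ℂ {v} := by
    by_contra! hall
    have h1 : Submodule.span ℂ {v} = ⊤ := Submodule.eq_top_iff'.2 hall
    have h2 := finrank_span_singleton (K := ℂ) hv0
    rw [h1, finrank_top, hE] at h2
    omega
  set L : ℂ × ℂ → E := fun p => a + (p.1 • w + p.2 • v) with hL
  have hLd : Differentiable ℂ L := by fun_prop
  have hLi : Function.Injective L := by
    rintro ⟨s, t⟩ ⟨s', t'⟩ hst
    have h1 := add_left_cancel hst
    simp only at h1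
    have h2 : (s - s') • w = (t' - t) • v := by
      rw [sub_smul, sub_smul, sub_eq_sub_iff_add_eq_add, h1, add_comm]
    have hss : s - s' = 0 := by
      by_contra hne
      apply hw
      rw [Submodule.mem_span_singleton]
      refine ⟨(s - s')⁻¹ * (t' - t), ?_⟩
      rw [mul_smul, ← h2, smul_smul, inv_mul_cancel₀ hne, one_smul]
    rw [hss, zero_smul] at h2
    rcases smul_eq_zero.1 h2.symm with h3 | h3
    · rw [Prod.mk.injEq]
      exact ⟨sub_eq_zero.1 hss, (sub_eq_zero.1 h3).symm⟩
    · exact absurd h3 hv0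
  have hL0 : L (0, 0) = a := by simp [hL]
  refine two_dim (P := L ⁻¹' ball a R) (H := fun p => h (L p)) (G := fun p => f (L p)) (s₀ := 0)
    (t₀ := 0) (isOpen_ball.preimage hLd.continuous)
    (hhd.comp hLd.differentiableOn (fun p hp => hRs hp))
    (hf.comp hLd.differentiableOn (fun p hp => hRs hp)) ?_ ?_ ?_ ?_ ?_
  · intro p hp p' hp' hpp
    exact hLi (hinj (hRs hp) (hRs hp') hpp)
  · intro p hp hp0
    have h1 : HasFDerivAt f (0 : E →L[ℂ] F) (L p) := by
      rw [← hzero (L p) (hRs hp) hp0]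
      exact (hf.differentiableAt (hs.mem_nhds (hRs hp))).hasFDerivAt
    have h2 := h1.comp p (hLd p).hasFDerivAt
    rw [ContinuousLinearMap.zero_comp] at h2
    exact h2.fderiv
  · rw [mem_preimage, hL0]; exact mem_ball_self hR
  · simp only [hL0]; exact hha
  · intro hev
    set m : ℂ → E := fun t => a + t • v with hm
    have hmd : Differentiable ℂ m := by fun_prop
    have hmL : ∀ t, L (0, t) = m t := fun t => by simp [hL, hm]
    have hopen : IsOpen (m ⁻¹' ball a R) := isOpen_ball.preimage hmd.continuous
    have hconn : IsPreconnected (m ⁻¹' ball a R) := by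
      have : m ⁻¹' ball a R = ball (0 : ℂ) (R / ‖v‖) := by
        ext t
        simp [hm, norm_smul, lt_div_iff₀ (norm_pos_iff.2 hv0)]
      rw [this]
      exact (convex_ball _ _).isPreconnected
    have hd : DifferentiableOn ℂ (fun t => h (m t)) (m ⁻¹' ball a R) :=
      hhd.comp hmd.differentiableOn (fun p hp => hRs hp)
    have h1 := (hd.analyticOnNhd hopen).eqOn_zero_of_preconnected_of_eventuallyEq_zero hconn
      (z₀ := 0) (by simp [hm, hR]) (by
        filter_upwards [hev] with t ht
        rw [hmL] at ht
        exact ht)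
    have h2 : m 1 = c := by simp [hm, hv]
    have h3 := h1 (x := 1) (by rw [mem_preimage, h2]; exact hc)
    simp only [h2] at h3
    exact hhc h3

theorem osgood (n : ℕ) : OsgoodP n := by
  induction n with
  | zero =>
    intro E F _ _ _ _ _ _ hE hF f s a hs ha hf hinj
    have := Module.finrank_zero_iff.1 hE
    exact Function.injective_of_subsingleton _
  | succ n ih =>
    intro E F _ _ _ _ _ _ hE hF f s a hs ha hf hinj
    by_cases h0 : fderiv ℂ f a = 0
    · exfalso
      cases n with
      | zero => exact osgood_dim1 hE hF hs ha hf hinj h0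
      | succ n =>
        exact osgood_dim2 hE hF hs ha hf hinj
          (fun x hx hne => osgood_step1 ih hE hF hs hx hf hinj hne) h0
    · exact osgood_step1 ih hE hF hs ha hf hinj h0

/-- the image is open and the inverse is holomorphic -/
theorem inj_inverse {E : Type} [NormedAddCommGroup E] [NormedSpace ℂ E]
    [FiniteDimensional ℂ E] {g f : E → E} {s : Set E} (hs : IsOpen s)
    (hg : DifferentiableOn ℂ g s) (hinj : InjOn g s) (hf : ∀ x ∈ s, f (g x) = x) :
    IsOpen (g '' s) ∧ DifferentiableOn ℂ f (g '' s) := by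
  have key : ∀ x ∈ s, g '' s ∈ 𝓝 (g x) ∧ DifferentiableAt ℂ f (g x) := by
    intro x hx
    have hi := osgood _ E E rfl rfl g s x hs hx hg hinj
    set A := fderiv ℂ g x with hA
    set A' : E ≃L[ℂ] E :=
      (LinearEquiv.ofInjectiveEndo (A : E →ₗ[ℂ] E) hi).toContinuousLinearEquiv with hA'
    have hAA : (A' : E →L[ℂ] E) = A := by ext y; rfl
    have hd : HasFDerivAt g (A' : E →L[ℂ] E) x := by
      rw [hAA]; exact (hg.differentiableAt (hs.mem_nhds hx)).hasFDerivAt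
    obtain ⟨Ψ, h1, h2, h3⟩ := loc_inv hs hx hg A' hd
    constructor
    · filter_upwards [h3] with y hy
      exact ⟨Ψ y, hy.2.1, hy.2.2⟩
    · have : f =ᶠ[𝓝 (g x)] Ψ := by
        filter_upwards [h3] with y hy
        rw [← hf _ hy.2.1, hy.2.2]
      exact h3.self_of_nhds.1.congr_of_eventuallyEq this
  constructor
  · rw [isOpen_iff_mem_nhds]
    rintro _ ⟨x, hx, rfl⟩
    exact (key x hx).1
  · rintro _ ⟨x, hx, rfl⟩
    exact (key x hx).2.differentiableWithinAt

end partD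

section partE
open Set Metric Filter Topology

section mob
variable {E : Type} [NormedAddCommGroup E] [InnerProductSpace ℂ E]

def mobS (a : E) : ℝ := Real.sqrt (1 - ‖a‖ ^ 2)

def mob (a w : E) : E :=
  (1 - inner ℂ a w)⁻¹ • ((1 - inner ℂ a w / (1 + (mobS a : ℂ))) • a - (mobS a : ℂ) • w)

theorem mobS_pos {a : E} (ha : ‖a‖ < 1) : 0 < mobS a := by
  apply Real.sqrt_pos.2
  nlinarith [norm_nonneg a]

theorem mobS_sq {a : E} (ha : ‖a‖ < 1) : mobS a ^ 2 = 1 - ‖a‖ ^ 2 := by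
  apply Real.sq_sqrt
  nlinarith [norm_nonneg a]

theorem mob_den {a w : E} (ha : ‖a‖ < 1) (hw : ‖w‖ < 1) : 1 - inner ℂ a w ≠ 0 := by
  intro h
  have h1 : inner ℂ a w = 1 := (sub_eq_zero.1 h).symm
  have h2 := norm_inner_le_norm (𝕜 := ℂ) a w
  rw [h1, norm_one] at h2
  nlinarith [norm_nonneg a, norm_nonneg w]

theorem mob_norm {a w : E} (ha : ‖a‖ < 1) :
    ‖(1 - inner ℂ a w / (1 + (mobS a : ℂ))) • a - (mobS a : ℂ) • w‖ ^ 2 =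
      ‖1 - inner ℂ a w‖ ^ 2 - mobS a ^ 2 * (1 - ‖w‖ ^ 2) := by
  have hs := mobS_pos ha
  have hs2 := mobS_sq ha
  set s := mobS a with hs'
  set c := inner ℂ a w with hc
  have hβ : (1 - c / (1 + (s : ℂ))) = ⟨1 - c.re / (1 + s), - (c.im / (1 + s))⟩ := by
    have h1 : c / (1 + (s : ℂ)) = c / ((1 + s : ℝ) : ℂ) := by push_cast; rfl
    rw [h1]
    apply Complex.ext
    · rw [Complex.sub_re, Complex.div_ofReal_re, Complex.one_re]
    · rw [Complex.sub_im, Complex.div_ofReal_im, Complex.one_im, zero_sub]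
  have h1 := norm_sub_sq (𝕜 := ℂ) ((1 - c / (1 + (s : ℂ))) • a) ((s : ℂ) • w)
  rw [h1, inner_smul_left, inner_smul_right, ← hc, norm_smul, norm_smul, mul_pow, mul_pow, hβ,
    Complex.sq_norm, Complex.sq_norm, Complex.sq_norm, Complex.normSq_apply, Complex.normSq_apply,
    Complex.normSq_apply]
  have h2 : ‖a‖ ^ 2 = 1 - s ^ 2 := by linarith
  rw [h2]
  simp
  field_simp
  ring

theorem mob_mem {a w : E} (ha : ‖a‖ < 1) (hw : ‖w‖ < 1) : ‖mob a w‖ < 1 := by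
  have hd := mob_den ha hw
  have hd' : 0 < ‖1 - inner ℂ a w‖ := norm_pos_iff.2 hd
  have h1 := mob_norm (w := w) ha
  rw [mob, norm_smul, norm_inv, inv_mul_lt_one₀ hd']
  apply lt_of_pow_lt_pow_left₀ 2 hd'.le
  rw [h1]
  have := mul_pos (pow_pos (mobS_pos ha) 2) (show 0 < 1 - ‖w‖ ^ 2 by nlinarith [norm_nonneg w])
  linarith

theorem mob_zero (a : E) : mob a 0 = a := by simp [mob]

theorem mob_invol {a w : E} (ha : ‖a‖ < 1) (hw : ‖w‖ < 1) : mob a (mob a w) = w := by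
  have hd := mob_den ha hw
  have hs := mobS_pos ha
  have hs2 : (mobS a : ℂ) ^ 2 = 1 - (‖a‖ : ℂ) ^ 2 := by
    have := mobS_sq ha
    exact_mod_cast congrArg (fun x : ℝ => (x : ℂ)) this
  have hin : inner ℂ a (mob a w) = (1 - (mobS a : ℂ) ^ 2 - inner ℂ a w) / (1 - inner ℂ a w) := by
    rw [mob, inner_smul_right, inner_sub_right, inner_smul_right, inner_smul_right,
      inner_self_eq_norm_sq_to_K]
    have h2 : ((‖a‖ : ℝ) : ℂ) ^ 2 = 1 - (mobS a : ℂ) ^ 2 := by rw [hs2]; ring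
    have h3 : 1 + (mobS a : ℂ) ≠ 0 := by
      have : (1 + mobS a : ℝ) ≠ 0 := by positivity
      exact_mod_cast this
    simp only [Complex.coe_algebraMap]
    rw [h2]
    field_simp
    ring
  have hs0 : (mobS a : ℂ) ≠ 0 := by exact_mod_cast hs.ne'
  have h3 : 1 + (mobS a : ℂ) ≠ 0 := by
    have : (1 + mobS a : ℝ) ≠ 0 := by positivity
    exact_mod_cast this
  rw [mob, hin, mob]
  set s := (mobS a : ℂ)
  set c := inner ℂ a w
  have e1 : (1 - (1 - s ^ 2 - c) / (1 - c))⁻¹ = (1 - c) / s ^ 2 := by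
    have : 1 - (1 - s ^ 2 - c) / (1 - c) = s ^ 2 / (1 - c) := by field_simp; ring
    rw [this, inv_div]
  rw [e1, smul_sub, smul_sub, smul_sub, smul_sub]
  simp only [smul_smul]
  have e2 : (1 - c) / s ^ 2 * (1 - (1 - s ^ 2 - c) / (1 - c) / (1 + s)) =
      (1 - c) / s ^ 2 * (s * ((1 - c)⁻¹ * (1 - c / (1 + s)))) := by
    field_simp
    ring
  have e3 : (1 - c) / s ^ 2 * (s * ((1 - c)⁻¹ * s)) = 1 := by
    field_simp
  rw [e2, e3, one_smul]
  abel

theorem mob_diff {a : E} (ha : ‖a‖ < 1) : DifferentiableOn ℂ (mob a) (ball 0 1) := by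
  have hin : Differentiable ℂ (fun w : E => inner ℂ a w) := (innerSL ℂ a).differentiable
  have h1 : DifferentiableOn ℂ (fun w : E => (1 - inner ℂ a w)⁻¹) (ball 0 1) := by
    refine DifferentiableOn.inv (hin.const_sub 1).differentiableOn fun w hw => ?_
    exact mob_den ha (by simpa using hw)
  refine h1.smul (Differentiable.differentiableOn ?_)
  simp only [div_eq_mul_inv]
  exact (((hin.mul_const _).const_sub 1).smul_const a).sub (differentiable_id.const_smul _)

theorem mob_renorm [FiniteDimensional ℂ E] {g : E → E} {D : Set E} (hg : DifferentiableOn ℂ g (ball 0 1))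
    (hinj : InjOn g (ball 0 1)) (hmap : MapsTo g (ball 0 1) D) {z : E} (hz : z ∈ g '' ball 0 1) :
    ∃ g' : E → E, DifferentiableOn ℂ g' (ball 0 1) ∧ InjOn g' (ball 0 1) ∧ MapsTo g' (ball 0 1) D ∧
      g' 0 = z ∧ g' '' ball 0 1 = g '' ball 0 1 := by
  obtain ⟨a, ha, rfl⟩ := hz
  have ha' : ‖a‖ < 1 := by simpa using ha
  have hm : MapsTo (mob a) (ball 0 1) (ball 0 1) := fun w hw => by
    rw [mem_ball_zero_iff] at hw ⊢
    exact mob_mem ha' hw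
  have hi : ∀ w ∈ ball (0 : E) 1, mob a (mob a w) = w := fun w hw => by
    rw [mem_ball_zero_iff] at hw
    exact mob_invol ha' hw
  refine ⟨fun w => g (mob a w), hg.comp (mob_diff ha') hm, ?_, fun w hw => hmap (hm hw), ?_, ?_⟩
  · intro w hw w' hw' h
    have := hinj (hm hw) (hm hw') h
    rw [← hi w hw, this, hi w' hw']
  · simp only [mob_zero]
  · ext y
    constructor
    · rintro ⟨w, hw, rfl⟩
      exact ⟨_, hm hw, rfl⟩
    · rintro ⟨w, hw, rfl⟩
      exact ⟨mob a w, hm hw, by simp only [hi w hw]⟩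
end mob

end partE

section partF
open Set Metric Filter Topology

theorem kappa_bdd (D : Set (Cn n)) (p X : Cn n) : BddBelow {x : ℝ | ∃ φ : ℂ → Cn n, DifferentiableOn ℂ φ (ball 0 1) ∧
    MapsTo φ (ball 0 1) D ∧ φ 0 = p ∧ ∃ l : ℂ, l • fderiv ℂ φ 0 1 = X ∧ x = ‖l‖} := by
  refine ⟨0, ?_⟩
  rintro x ⟨φ, -, -, -, l, -, rfl⟩
  exact norm_nonneg l

theorem kappa_nonneg (D : Set (Cn n)) (p X : Cn n) : 0 ≤ kappaRoyden D p X := by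
  apply Real.sInf_nonneg
  rintro x ⟨φ, -, -, -, l, -, rfl⟩
  exact norm_nonneg l

theorem kappa_le {D : Set (Cn n)} {p X : Cn n} {φ : ℂ → Cn n} (h1 : DifferentiableOn ℂ φ (ball 0 1))
    (h2 : MapsTo φ (ball 0 1) D) (h3 : φ 0 = p) {l : ℂ} (h4 : l • deriv φ 0 = X) :
    kappaRoyden D p X ≤ ‖l‖ :=
  csInf_le (kappa_bdd D p X) ⟨φ, h1, h2, h3, l, by rw [fderiv_apply_one_eq_deriv]; exact h4, rfl⟩

/-- an affine disc -/
theorem affine_disc {D : Set (Cn n)} {p X : Cn n} {δ : ℝ} (hδ : 0 < δ) (hb : ball p δ ⊆ D)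
    (hX : ‖X‖ ≤ δ) : DifferentiableOn ℂ (fun ζ : ℂ => p + ζ • X) (ball 0 1) ∧
      MapsTo (fun ζ : ℂ => p + ζ • X) (ball 0 1) D := by
  refine ⟨by fun_prop, fun ζ hζ => hb ?_⟩
  rw [mem_ball_zero_iff] at hζ
  rw [mem_ball, dist_eq_norm, add_sub_cancel_left, norm_smul]
  calc ‖ζ‖ * ‖X‖ ≤ ‖ζ‖ * δ := by gcongr
    _ < δ := by nlinarith

theorem deriv_affine (p X : Cn n) : deriv (fun ζ : ℂ => p + ζ • X) 0 = X := by
  have : HasDerivAt (fun ζ : ℂ => p + ζ • X) ((1 : ℂ) • X) 0 :=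
    ((hasDerivAt_id (0 : ℂ)).smul_const X).const_add p
  rw [this.deriv, one_smul]

theorem kappa_exists {D : Set (Cn n)} (hD : IsOpen D) {p : Cn n} (hp : p ∈ D) (X : Cn n) {r : ℝ}
    (hr : kappaRoyden D p X < r) : ∃ φ : ℂ → Cn n, DifferentiableOn ℂ φ (ball 0 1) ∧
    MapsTo φ (ball 0 1) D ∧ φ 0 = p ∧ ∃ l : ℂ, l • deriv φ 0 = X ∧ ‖l‖ < r := by
  obtain ⟨δ, hδ, hb⟩ := Metric.isOpen_iff.1 hD p hp
  have hne : {x : ℝ | ∃ φ : ℂ → Cn n, DifferentiableOn ℂ φ (ball 0 1) ∧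
    MapsTo φ (ball 0 1) D ∧ φ 0 = p ∧ ∃ l : ℂ, l • fderiv ℂ φ 0 1 = X ∧ x = ‖l‖}.Nonempty := by
    have hn : ‖((δ / (‖X‖ + 1) : ℝ) : ℂ) • X‖ ≤ δ := by
      rw [norm_smul, Complex.norm_real, Real.norm_eq_abs, abs_of_pos (by positivity), div_mul_eq_mul_div,
        div_le_iff₀ (by positivity)]
      nlinarith [norm_nonneg X]
    obtain ⟨h1, h2⟩ := affine_disc hδ hb hn
    refine ⟨_, _, h1, h2, by simp, (((δ / (‖X‖ + 1))⁻¹ : ℝ) : ℂ), ?_, rfl⟩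
    rw [fderiv_apply_one_eq_deriv, deriv_affine, smul_smul, ← Complex.ofReal_mul,
      inv_mul_cancel₀ (by positivity), Complex.ofReal_one, one_smul]
  obtain ⟨x, ⟨φ, h1, h2, h3, l, h4, rfl⟩, hx⟩ := exists_lt_of_csInf_lt hne hr
  rw [fderiv_apply_one_eq_deriv] at h4
  exact ⟨φ, h1, h2, h3, l, h4, hx⟩

theorem kappa_smul_le {D : Set (Cn n)} (hD : IsOpen D) {p : Cn n} (hp : p ∈ D) (X : Cn n) {c : ℝ}
    (hc : 0 ≤ c) : kappaRoyden D p (c • X) ≤ c * kappaRoyden D p X := by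
  refine le_of_forall_gt_imp_ge_of_dense fun r hr => ?_
  have : ∃ r' > kappaRoyden D p X, c * r' ≤ r := by
    rcases hc.eq_or_lt with rfl | hc
    · exact ⟨kappaRoyden D p X + 1, by linarith, by linarith⟩
    · refine ⟨r / c, (lt_div_iff₀ hc).2 (by linarith), by field_simp; rfl⟩
  obtain ⟨r', hr', hcr⟩ := this
  obtain ⟨φ, h1, h2, h3, l, h4, h5⟩ := kappa_exists hD hp X hr'
  have : kappaRoyden D p (c • X) ≤ ‖(c : ℂ) * l‖ := by
    refine kappa_le h1 h2 h3 ?_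
    rw [mul_smul, h4]
    simp
  rw [norm_mul, Complex.norm_real, Real.norm_eq_abs, abs_of_nonneg hc] at this
  nlinarith

theorem kappa_smul {D : Set (Cn n)} (hD : IsOpen D) {p : Cn n} (hp : p ∈ D) (X : Cn n) {c : ℝ}
    (hc : 0 ≤ c) : kappaRoyden D p (c • X) = c * kappaRoyden D p X := by
  refine le_antisymm (kappa_smul_le hD hp X hc) ?_
  rcases hc.eq_or_lt with rfl | hc
  · rw [zero_mul]; exact kappa_nonneg _ _ _
  · have h1 := kappa_smul_le hD hp (c • X) (inv_nonneg.2 hc.le)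
    rw [smul_smul, inv_mul_cancel₀ hc.ne', one_smul] at h1
    calc c * kappaRoyden D p X ≤ c * (c⁻¹ * kappaRoyden D p (c • X)) := by gcongr
      _ = _ := by field_simp

theorem kobLength_nonneg (D : Set (Cn n)) (γ : ℝ → Cn n) : 0 ≤ kobLength D γ :=
  intervalIntegral.integral_nonneg zero_le_one fun _ _ => kappa_nonneg _ _ _

theorem kob_le {D : Set (Cn n)} {z w : Cn n} {γ : ℝ → Cn n} (h : IsCurve D γ z w) :
    kobayashi D z w ≤ kobLength D γ :=
  csInf_le ⟨0, by rintro _ ⟨γ, -, rfl⟩; exact kobLength_nonneg _ _⟩ ⟨γ, h, rfl⟩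

theorem kob_self_nonpos {D : Set (Cn n)} {z : Cn n} (h : z ∈ D) (hD : IsOpen D) :
    kobayashi D z z ≤ 0 := by
  have hc : IsCurve D (fun _ => z) z z := ⟨contDiffOn_const, fun _ _ => h, rfl, rfl⟩
  have h0 : kappaRoyden D z 0 = 0 := by
    have := kappa_smul hD h 0 (le_refl (0 : ℝ))
    simpa using this
  have : kobLength D (fun _ => z) = 0 := by simp [kobLength, h0]
  exact (kob_le hc).trans this.le

/-- the length of a disc path -/
theorem disc_curve {D : Set (Cn n)} {φ : ℂ → Cn n} (h1 : DifferentiableOn ℂ φ (ball 0 1))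
    (h2 : MapsTo φ (ball 0 1) D) {ρ : ℝ} (h0 : 0 ≤ ρ) (hρ : ρ < 1) :
    ∃ γ, IsCurve D γ (φ 0) (φ ρ) ∧ kobLength D γ ≤ ρ / (1 - ρ) := by
  have hmem : ∀ t ∈ Icc (0 : ℝ) 1, ((t * ρ : ℝ) : ℂ) ∈ ball (0 : ℂ) 1 := fun t ht => by
    rw [mem_ball_zero_iff, Complex.norm_real, Real.norm_eq_abs, abs_of_nonneg (mul_nonneg ht.1 h0)]
    nlinarith [ht.2]
  have hder : ∀ t ∈ Icc (0 : ℝ) 1, HasDerivAt (fun t : ℝ => φ ((t * ρ : ℝ) : ℂ))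
      ((ρ : ℂ) • deriv φ ((t * ρ : ℝ) : ℂ)) t := by
    intro t ht
    have e1 : HasDerivAt φ (deriv φ ((t * ρ : ℝ) : ℂ)) ((t * ρ : ℝ) : ℂ) :=
      (h1.differentiableAt (isOpen_ball.mem_nhds (hmem t ht))).hasDerivAt
    have e2 : HasDerivAt (fun t : ℝ => ((t * ρ : ℝ) : ℂ)) (ρ : ℂ) t := by
      have := ((hasDerivAt_id t).mul_const ρ).ofReal_comp
      rw [one_mul] at this
      exact this
    exact e1.scomp t e2
  refine ⟨fun t => φ ((t * ρ : ℝ) : ℂ), ⟨?_, fun t ht => h2 (hmem t ht), by simp, by simp⟩, ?_⟩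
  · have hC : ContDiffOn ℝ 1 φ (ball 0 1) := (sv_contDiffOn_nat isOpen_ball 1 h1).restrict_scalars ℝ
    refine hC.comp (ContDiff.contDiffOn ?_) hmem
    exact Complex.ofRealCLM.contDiff.comp (contDiff_id.mul contDiff_const)
  · have hb := intervalIntegral.norm_integral_le_of_norm_le_const (a := 0) (b := 1) (C := ρ / (1 - ρ))
      (f := fun t => kappaRoyden D (φ ((t * ρ : ℝ) : ℂ)) (deriv (fun t : ℝ => φ ((t * ρ : ℝ) : ℂ)) t)) ?_
    · rw [sub_zero, abs_one, mul_one] at hb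
      exact (le_abs_self _).trans hb
    intro t ht
    rw [uIoc_of_le zero_le_one] at ht
    have ht' : t ∈ Icc (0 : ℝ) 1 := ⟨ht.1.le, ht.2⟩
    rw [Real.norm_eq_abs, abs_of_nonneg (kappa_nonneg _ _ _), (hder t ht').deriv]
    set q : ℂ := ((t * ρ : ℝ) : ℂ) with hq
    have hqn : ‖q‖ ≤ ρ := by
      rw [hq, Complex.norm_real, Real.norm_eq_abs, abs_of_nonneg (mul_nonneg ht'.1 h0)]
      nlinarith [ht.2]
    set δ : ℝ := 1 - ρ with hδ
    have hδ0 : 0 < δ := by linarith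
    have hδn : ‖(δ : ℂ)‖ = δ := by rw [Complex.norm_real, Real.norm_eq_abs, abs_of_pos hδ0]
    have hm : MapsTo (fun ζ : ℂ => q + (δ : ℂ) * ζ) (ball 0 1) (ball 0 1) := fun ζ hζ => by
      rw [mem_ball_zero_iff] at hζ ⊢
      calc ‖q + (δ : ℂ) * ζ‖ ≤ ‖q‖ + ‖(δ : ℂ) * ζ‖ := norm_add_le _ _
        _ = ‖q‖ + δ * ‖ζ‖ := by rw [norm_mul, hδn]
        _ < 1 := by nlinarith
    have e2 : HasDerivAt (fun ζ : ℂ => q + (δ : ℂ) * ζ) (δ : ℂ) 0 := by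
      simpa using ((hasDerivAt_id (0 : ℂ)).const_mul (δ : ℂ)).const_add q
    have e1 : HasDerivAt φ (deriv φ q) (q + (δ : ℂ) * 0) := by
      rw [mul_zero, add_zero]
      exact (h1.differentiableAt (isOpen_ball.mem_nhds (hmem t ht'))).hasDerivAt
    have e3 := (e1.scomp (0 : ℂ) e2).deriv
    have := kappa_le (D := D) (p := φ q) (X := (ρ : ℂ) • deriv φ q) (φ := fun ζ => φ (q + (δ : ℂ) * ζ))
      (l := ((ρ / δ : ℝ) : ℂ)) (h1.comp (by fun_prop) hm) (h2.comp hm) (by simp) (by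
        have e4 : deriv (fun ζ => φ (q + (δ : ℂ) * ζ)) 0 = (δ : ℂ) • deriv φ q := e3
        rw [e4, smul_smul, ← Complex.ofReal_mul, div_mul_cancel₀ _ hδ0.ne'])
    rwa [Complex.norm_real, Real.norm_eq_abs, abs_of_nonneg (by positivity)] at this

/-- reparametrisation -/
theorem reparam {D : Set (Cn n)} (hD : IsOpen D) {γ : ℝ → Cn n} (hγ : ContDiffOn ℝ 1 γ (Icc 0 1))
    (hγD : MapsTo γ (Icc 0 1) D) {σ : ℝ → ℝ} (hσ : Differentiable ℝ σ) (hm : Monotone σ) {a b : ℝ}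
    (hab : a ≤ b) (hI : MapsTo σ (Ioo a b) (Ioo 0 1)) :
    ∫ t in a..b, kappaRoyden D (γ (σ t)) (deriv (fun t => γ (σ t)) t) =
      ∫ t in (σ a)..(σ b), kappaRoyden D (γ t) (deriv γ t) := by
  have h1 : ∀ t ∈ Ioo a b, kappaRoyden D (γ (σ t)) (deriv (fun t => γ (σ t)) t) =
      deriv σ t • kappaRoyden D (γ (σ t)) (deriv γ (σ t)) := by
    intro t ht
    have h2 := hI ht
    have e1 : HasDerivAt γ (deriv γ (σ t)) (σ t) :=
      ((hγ.contDiffAt (Icc_mem_nhds h2.1 h2.2)).differentiableAt (by simp)).hasDerivAt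
    have e3 : deriv (fun t => γ (σ t)) t = deriv σ t • deriv γ (σ t) :=
      (e1.scomp t (hσ t).hasDerivAt).deriv
    rw [e3, kappa_smul hD (hγD (Ioo_subset_Icc_self h2)) _ hm.deriv_nonneg, smul_eq_mul]
  rw [intervalIntegral.integral_congr_Ioo_of_le hab h1, intervalIntegral.integral_of_le hab,
    intervalIntegral.integral_of_le (hm hab), ← MeasureTheory.integral_Icc_eq_integral_Ioc,
    ← MeasureTheory.integral_Icc_eq_integral_Ioc]
  exact MeasureTheory.integral_Icc_deriv_smul_of_deriv_nonneg (f := σ) (f' := deriv σ)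
    (g := fun t => kappaRoyden D (γ t) (deriv γ t)) hσ.continuous.continuousOn
    (fun x hx => (hσ x).hasDerivAt) (fun x hx => hm.deriv_nonneg) hab

end partF

section partG
open Set Metric Filter Topology

/-- triangle inequality at the level of curves -/
theorem glue {D : Set (Cn n)} (hD : IsOpen D) {γ η : ℝ → Cn n} {z p q : Cn n}
    (hγ : IsCurve D γ z p) (hη : IsCurve D η p q) :
    ∃ θ, IsCurve D θ z q ∧ kobLength D θ ≤ kobLength D γ + kobLength D η := by
  obtain ⟨g1, g2, g3, g4⟩ := hγ
  obtain ⟨e1, e2, e3, e4⟩ := hη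
  set σ : ℝ → ℝ := fun t => Real.smoothTransition (2 * t) with hσ
  set τ : ℝ → ℝ := fun t => Real.smoothTransition (2 * t - 1) with hτ
  have hsm : ContDiff ℝ 1 Real.smoothTransition := Real.smoothTransition.contDiff (n := 1)
  have hσc : ContDiff ℝ 1 σ := hsm.comp (contDiff_const.mul contDiff_id)
  have hτc : ContDiff ℝ 1 τ := hsm.comp ((contDiff_const.mul contDiff_id).sub contDiff_const)
  have hσm : Monotone σ := fun s t hst => Real.smoothTransition.monotone (by linarith)
  have hτm : Monotone τ := fun s t hst => Real.smoothTransition.monotone (by linarith)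
  have hσI : ∀ t, σ t ∈ Icc (0 : ℝ) 1 := fun t =>
    ⟨Real.smoothTransition.nonneg _, Real.smoothTransition.le_one _⟩
  have hτI : ∀ t, τ t ∈ Icc (0 : ℝ) 1 := fun t =>
    ⟨Real.smoothTransition.nonneg _, Real.smoothTransition.le_one _⟩
  have hσ1 : ∀ t, 1 / 2 ≤ t → σ t = 1 := fun t ht =>
    Real.smoothTransition.one_of_one_le (by linarith)
  have hτ0 : ∀ t, t ≤ 1 / 2 → τ t = 0 := fun t ht =>
    Real.smoothTransition.zero_of_nonpos (by linarith)
  have hσ0 : σ 0 = 0 := Real.smoothTransition.zero_of_nonpos (by norm_num)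
  have hτ1 : τ 1 = 1 := Real.smoothTransition.one_of_one_le (by norm_num)
  set θ : ℝ → Cn n := fun t => γ (σ t) + (η (τ t) - p) with hθ
  have hθ1 : ∀ t, t ≤ 1 / 2 → θ t = γ (σ t) := fun t ht => by simp [hθ, hτ0 t ht, e3]
  have hθ2 : ∀ t, 1 / 2 ≤ t → θ t = η (τ t) := fun t ht => by simp [hθ, hσ1 t ht, g4]
  have hθc : IsCurve D θ z q := by
    refine ⟨?_, ?_, ?_, ?_⟩
    · exact (g1.comp hσc.contDiffOn (fun t _ => hσI t)).add
        ((e1.comp hτc.contDiffOn (fun t _ => hτI t)).sub contDiffOn_const)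
    · intro t _
      rcases le_total t (1 / 2) with h | h
      · rw [hθ1 t h]; exact g2 (hσI t)
      · rw [hθ2 t h]; exact e2 (hτI t)
    · rw [hθ1 0 (by norm_num), hσ0, g3]
    · rw [hθ2 1 (by norm_num), hτ1, e4]
  refine ⟨θ, hθc, ?_⟩
  by_cases hintg : IntervalIntegrable (fun t => kappaRoyden D (θ t) (deriv θ t)) MeasureTheory.volume 0 1
  swap
  · rw [kobLength, intervalIntegral.integral_undef hintg]
    exact add_nonneg (kobLength_nonneg _ _) (kobLength_nonneg _ _)
  have hi1 : IntervalIntegrable (fun t => kappaRoyden D (θ t) (deriv θ t)) MeasureTheory.volume 0 (1 / 2) :=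
    hintg.mono_set (by rw [uIcc_of_le, uIcc_of_le] <;> first | exact Icc_subset_Icc (by norm_num) (by norm_num) | norm_num)
  have hi2 : IntervalIntegrable (fun t => kappaRoyden D (θ t) (deriv θ t)) MeasureTheory.volume (1 / 2) 1 :=
    hintg.mono_set (by rw [uIcc_of_le, uIcc_of_le] <;> first | exact Icc_subset_Icc (by norm_num) (by norm_num) | norm_num)
  have ha : ∫ t in (0 : ℝ)..(1 / 2), kappaRoyden D (θ t) (deriv θ t) = kobLength D γ := by
    have := reparam hD g1 g2 (hσc.differentiable (by simp)) hσm (a := 0) (b := 1 / 2) (by norm_num)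
      (fun t ht => ⟨Real.smoothTransition.pos_of_pos (by linarith [ht.1]),
        Real.smoothTransition.lt_one_of_lt_one (by linarith [ht.2])⟩)
    rw [hσ0, hσ1 _ le_rfl] at this
    rw [kobLength, ← this]
    refine intervalIntegral.integral_congr_Ioo_of_le (by norm_num) fun t ht => ?_
    have hev : θ =ᶠ[𝓝 t] fun t => γ (σ t) := by
      filter_upwards [Iio_mem_nhds ht.2] with s hs using hθ1 s (le_of_lt hs)
    rw [hev.deriv_eq, hev.self_of_nhds]
  have hb : ∫ t in (1 / 2 : ℝ)..1, kappaRoyden D (θ t) (deriv θ t) = kobLength D η := by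
    have := reparam hD e1 e2 (hτc.differentiable (by simp)) hτm (a := 1 / 2) (b := 1) (by norm_num)
      (fun t ht => ⟨Real.smoothTransition.pos_of_pos (by linarith [ht.1]),
        Real.smoothTransition.lt_one_of_lt_one (by linarith [ht.2])⟩)
    rw [hτ1, hτ0 _ le_rfl] at this
    rw [kobLength, ← this]
    refine intervalIntegral.integral_congr_Ioo_of_le (by norm_num) fun t ht => ?_
    have hev : θ =ᶠ[𝓝 t] fun t => η (τ t) := by
      filter_upwards [Ioi_mem_nhds ht.1] with s hs using hθ2 s (le_of_lt hs)
    rw [hev.deriv_eq, hev.self_of_nhds]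
  rw [kobLength, ← intervalIntegral.integral_add_adjacent_intervals hi1 hi2, ha, hb]

/-- restriction of an integrable curve -/
theorem restrict_curve {D : Set (Cn n)} (hD : IsOpen D) {γ : ℝ → Cn n} {z w : Cn n}
    (hγ : IsCurve D γ z w)
    (hintg : IntervalIntegrable (fun t => kappaRoyden D (γ t) (deriv γ t)) MeasureTheory.volume 0 1)
    {t : ℝ} (ht : t ∈ Icc (0 : ℝ) 1) :
    ∃ θ, IsCurve D θ z (γ t) ∧ kobLength D θ ≤ kobLength D γ := by
  obtain ⟨g1, g2, g3, g4⟩ := hγ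
  have hmt : ∀ s ∈ Icc (0 : ℝ) 1, t * s ∈ Icc (0 : ℝ) 1 := fun s hs =>
    ⟨mul_nonneg ht.1 hs.1, mul_le_one₀ ht.2 hs.1 hs.2⟩
  have hc : IsCurve D (fun s => γ (t * s)) z (γ t) := by
    refine ⟨?_, fun s hs => g2 (hmt s hs), by simp [g3], by simp⟩
    exact g1.comp (contDiff_const.mul contDiff_id).contDiffOn hmt
  refine ⟨_, hc, ?_⟩
  rcases ht.1.eq_or_lt with h0 | h0
  · have : kobLength D (fun s => γ (t * s)) = 0 := by
      have hz : kappaRoyden D (γ 0) 0 = 0 := by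
        have := kappa_smul hD (g2 ⟨le_rfl, zero_le_one⟩) 0 (le_refl (0 : ℝ))
        simpa using this
      simp [kobLength, ← h0, hz]
    rw [this]; exact kobLength_nonneg _ _
  have := reparam hD g1 g2 (σ := fun s => t * s) (by fun_prop)
    (fun s s' h => mul_le_mul_of_nonneg_left h ht.1) (a := 0) (b := 1) zero_le_one
    (fun s hs => ⟨mul_pos h0 hs.1, by nlinarith [hs.1, hs.2, ht.2]⟩)
  simp only [mul_zero, mul_one] at this
  rw [kobLength, this, kobLength]
  refine intervalIntegral.integral_mono_interval le_rfl ht.1 ht.2 ?_ hintg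
  exact Eventually.of_forall fun s => kappa_nonneg _ _ _

theorem seg_curve {D : Set (Cn n)} {c x : Cn n} {ε : ℝ} (hε : 0 < ε)
    (hb : ball c ε ⊆ D) (hx : ‖x - c‖ ≤ ε / 2) :
    ∃ γ, IsCurve D γ c x ∧ kobLength D γ ≤ 1 := by
  have hn : ‖(2 : ℂ) • (x - c)‖ ≤ ε := by
    rw [norm_smul]
    simp
    linarith
  obtain ⟨h1, h2⟩ := affine_disc hε hb hn
  obtain ⟨γ, h3, h4⟩ := disc_curve h1 h2 (ρ := 1 / 2) (by norm_num) (by norm_num)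
  refine ⟨γ, ?_, by norm_num at h4; exact h4⟩
  convert h3 using 1
  · simp
  · simp [smul_smul]

theorem seg_curve' {D : Set (Cn n)} {c x : Cn n} {ε : ℝ} (hε : 0 < ε)
    (hb : ball c ε ⊆ D) (hx : ‖x - c‖ ≤ ε / 4) :
    ∃ γ, IsCurve D γ x c ∧ kobLength D γ ≤ 1 := by
  refine seg_curve (ε := ε / 2) (by positivity) (fun y hy => hb ?_) ?_
  · rw [mem_ball] at hy ⊢
    have := dist_triangle y x c
    rw [dist_eq_norm x c] at this
    linarith
  · rw [norm_sub_rev]; linarith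

theorem exists_curve {D : Set (Cn n)} (hD : IsOpen D) (hc : IsConnected D) {z : Cn n} (hz : z ∈ D)
    {w : Cn n} (hw : w ∈ D) : ∃ γ, IsCurve D γ z w := by
  set S : Set (Cn n) := {w | w ∈ D ∧ ∃ γ, IsCurve D γ z w} with hS
  have : D ⊆ S := by
    refine hc.isPreconnected.subset_of_closure_inter_subset ?_ ?_ ?_
    · rw [Metric.isOpen_iff]
      rintro w ⟨hw, γ, hγ⟩
      obtain ⟨ε, hε, hb⟩ := Metric.isOpen_iff.1 hD w hw
      refine ⟨ε / 2, by positivity, fun x hx => ⟨hb (ball_subset_ball (by linarith) hx), ?_⟩⟩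
      obtain ⟨η, hη, -⟩ := seg_curve (x := x) hε hb (by rw [mem_ball, dist_eq_norm] at hx; exact hx.le)
      obtain ⟨θ, hθ, -⟩ := glue hD hγ hη
      exact ⟨θ, hθ⟩
    · exact ⟨z, hz, hz, fun _ => z, contDiffOn_const, fun _ _ => hz, rfl, rfl⟩
    · rintro w ⟨hwS, hw⟩
      obtain ⟨ε, hε, hb⟩ := Metric.isOpen_iff.1 hD w hw
      obtain ⟨x, ⟨hx, γ, hγ⟩, hxw⟩ := Metric.mem_closure_iff.1 hwS (ε / 4) (by positivity)
      obtain ⟨η, hη, -⟩ := seg_curve' (x := x) hε hb (by rw [dist_comm, dist_eq_norm] at hxw; exact hxw.le)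
      obtain ⟨θ, hθ, -⟩ := glue hD hγ hη
      exact ⟨hw, θ, hθ⟩
  exact (this hw).2

theorem kob_loc_bdd {D : Set (Cn n)} (hD : IsOpen D) (hc : IsConnected D) {z : Cn n} (hz : z ∈ D)
    {w : Cn n} (hw : w ∈ D) : ∃ ε > 0, ∃ C : ℝ, 0 < C ∧ ball w ε ⊆ D ∧ ∀ x ∈ ball w ε, kobayashi D z x < C := by
  obtain ⟨γ, hγ⟩ := exists_curve hD hc hz hw
  obtain ⟨ε, hε, hb⟩ := Metric.isOpen_iff.1 hD w hw
  refine ⟨ε / 2, by positivity, kobLength D γ + 2, by linarith [kobLength_nonneg D γ],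
    (ball_subset_ball (by linarith)).trans hb, fun x hx => ?_⟩
  obtain ⟨η, hη, hη'⟩ := seg_curve (x := x) hε hb (by rw [mem_ball, dist_eq_norm] at hx; exact hx.le)
  obtain ⟨θ, hθ, hθ'⟩ := glue hD hγ hη
  have := kob_le hθ
  linarith

/-- images of balls have bounded Kobayashi distance -/
theorem kob_ball_bdd {D : Set (Cn n)} {g : Cn n → Cn n} (hg : DifferentiableOn ℂ g (ball 0 1))
    (hm : MapsTo g (ball 0 1) D) {x : Cn n} {ρ : ℝ} (hx : ‖x‖ ≤ ρ) (hρ : ρ < 1) :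
    kobayashi D (g 0) (g x) ≤ ρ / (1 - ρ) := by
  set u : Cn n := ((‖x‖⁻¹ : ℝ) : ℂ) • x with hu
  have hu1 : ‖u‖ ≤ 1 := by
    rw [hu, norm_smul, Complex.norm_real, norm_inv, norm_norm]
    exact inv_mul_le_one
  have hux : ((‖x‖ : ℝ) : ℂ) • u = x := by
    rcases eq_or_ne x 0 with h | h
    · simp [h, hu]
    · rw [hu, smul_smul, ← Complex.ofReal_mul, mul_inv_cancel₀ (norm_ne_zero_iff.2 h)]
      simp
  have hmu : MapsTo (fun ζ : ℂ => ζ • u) (ball 0 1) (ball 0 1) := fun ζ hζ => by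
    rw [mem_ball_zero_iff] at hζ ⊢
    rw [norm_smul]
    nlinarith [norm_nonneg ζ, norm_nonneg u]
  obtain ⟨γ, h1, h2⟩ := disc_curve (D := D) (φ := fun ζ => g (ζ • u)) (hg.comp (by fun_prop) hmu) (hm.comp hmu)
    (norm_nonneg x) (hx.trans_lt hρ)
  simp only [hux, zero_smul] at h1
  have h3 := (kob_le h1).trans h2
  refine h3.trans ?_
  apply div_le_div₀ <;> linarith [norm_nonneg x]

/-- discs of radius one half -/
theorem kob_disc {D : Set (Cn n)} {φ : ℂ → Cn n} (h1 : DifferentiableOn ℂ φ (ball 0 1))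
    (h2 : MapsTo φ (ball 0 1) D) {ζ : ℂ} (hζ : ‖ζ‖ ≤ 1 / 2) :
    ∃ γ, IsCurve D γ (φ 0) (φ ζ) ∧ kobLength D γ ≤ 1 := by
  have hm : MapsTo (fun ξ : ℂ => ξ * (2 * ζ)) (ball 0 1) (ball 0 1) := fun ξ hξ => by
    rw [mem_ball_zero_iff] at hξ ⊢
    rw [norm_mul, norm_mul]
    simp
    nlinarith [norm_nonneg ξ, norm_nonneg ζ]
  obtain ⟨γ, h3, h4⟩ := disc_curve (D := D) (φ := fun ξ => φ (ξ * (2 * ζ))) (h1.comp (by fun_prop) hm) (h2.comp hm)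
    (ρ := 1 / 2) (by norm_num) (by norm_num)
  refine ⟨γ, ?_, by norm_num at h4; exact h4⟩
  convert h3 using 2
  · simp
  · push_cast; ring

end partG

section partH
open Set Metric Filter Topology

/-- Schwarz-Pick at the origin, with real value -/
theorem schwarz_pick {u : ℂ → ℂ} (hu : DifferentiableOn ℂ u (ball 0 1))
    (hm : MapsTo u (ball 0 1) (ball 0 1)) {a : ℝ} (ha0 : 0 ≤ a) (ha1 : a < 1) (hua : u 0 = a) :
    ‖deriv u 0‖ ≤ 1 - a ^ 2 := by
  have hden : ∀ ζ ∈ ball (0 : ℂ) 1, 1 - a * u ζ ≠ 0 := by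
    intro ζ hζ h
    have h1 : (a : ℂ) * u ζ = 1 := (sub_eq_zero.1 h).symm
    have h2 := congrArg norm h1
    have h3 := hm hζ
    rw [mem_ball_zero_iff] at h3
    rw [norm_mul, Complex.norm_real, Real.norm_eq_abs, abs_of_nonneg ha0, norm_one] at h2
    nlinarith [norm_nonneg (u ζ)]
  set v : ℂ → ℂ := fun ζ => (u ζ - a) / (1 - a * u ζ) with hv
  have hvd : DifferentiableOn ℂ v (ball 0 1) := (hu.sub_const _).div ((hu.const_mul _).const_sub _) hden
  have hv0 : v 0 = 0 := by simp [hv, hua]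
  have hvm : MapsTo v (ball 0 1) (closedBall (v 0) 1) := by
    intro ζ hζ
    rw [hv0, mem_closedBall_zero_iff]
    simp only [hv]
    rw [norm_div, div_le_one (norm_pos_iff.2 (hden ζ hζ))]
    have h3 := hm hζ
    rw [mem_ball_zero_iff] at h3
    refine (pow_le_pow_iff_left₀ (norm_nonneg _) (norm_nonneg _) two_ne_zero).1 ?_
    have h4 : ‖u ζ‖ ^ 2 < 1 := by nlinarith [norm_nonneg (u ζ)]
    rw [Complex.sq_norm, Complex.normSq_apply] at h4 ⊢
    rw [Complex.sq_norm, Complex.normSq_apply]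
    simp
    nlinarith [mul_nonneg (show 0 ≤ 1 - a ^ 2 by nlinarith) (show 0 ≤ 1 - ((u ζ).re * (u ζ).re + (u ζ).im * (u ζ).im) by linarith)]
  have h1 := Complex.norm_deriv_le_one_of_mapsTo_ball hvd hvm one_pos
  have hud : HasDerivAt u (deriv u 0) 0 :=
    (hu.differentiableAt (ball_mem_nhds _ one_pos)).hasDerivAt
  have hvd' : deriv v 0 = deriv u 0 / (1 - a ^ 2) := by
    have h2 := ((hud.sub_const (a : ℂ)).div ((hud.const_mul (a : ℂ)).const_sub 1) (hden 0 (mem_ball_self one_pos))).deriv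
    have h5 : deriv v 0 = _ := h2
    have h3 := hden 0 (mem_ball_self one_pos)
    rw [hua, ← pow_two] at h3
    rw [h5]
    simp only [hua]
    rw [← pow_two, sub_self, zero_mul, sub_zero, pow_two (1 - (a : ℂ) ^ 2), mul_div_mul_right _ _ h3]
  have hpos : 0 < 1 - a ^ 2 := by nlinarith
  have h6 : ‖(1 : ℂ) - (a : ℂ) ^ 2‖ = 1 - a ^ 2 := by
    have : (1 : ℂ) - (a : ℂ) ^ 2 = ((1 - a ^ 2 : ℝ) : ℂ) := by push_cast; ring
    rw [this, Complex.norm_real, Real.norm_eq_abs, abs_of_pos hpos]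
  rw [hvd', norm_div, h6, div_le_one hpos] at h1
  exact h1

theorem schwarz_pick_ball {ψ : ℂ → Cn n} (hψ : DifferentiableOn ℂ ψ (ball 0 1))
    (hm : MapsTo ψ (ball 0 1) (ball 0 1)) :
    ‖inner ℂ (ψ 0) (deriv ψ 0)‖ ≤ 1 - ‖ψ 0‖ ^ 2 := by
  have h0 := hm (mem_ball_self one_pos)
  rw [mem_ball_zero_iff] at h0
  set q := ψ 0 with hq
  rcases eq_or_ne q 0 with h | h
  · simp [h]
  have hqn : 0 < ‖q‖ := norm_pos_iff.2 h
  set c : ℂ := ((‖q‖⁻¹ : ℝ) : ℂ) with hc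
  have hcn : ‖c‖ = ‖q‖⁻¹ := by rw [hc, Complex.norm_real, norm_inv, norm_norm]
  have hd : DifferentiableOn ℂ (fun ζ => c * inner ℂ q (ψ ζ)) (ball 0 1) :=
    ((innerSL ℂ q).differentiable.comp_differentiableOn hψ).const_mul c
  have hmm : MapsTo (fun ζ => c * inner ℂ q (ψ ζ)) (ball 0 1) (ball 0 1) := by
    intro ζ hζ
    have h1 := hm hζ
    rw [mem_ball_zero_iff] at h1 ⊢
    have h2 := norm_inner_le_norm (𝕜 := ℂ) q (ψ ζ)
    rw [norm_mul, hcn, inv_mul_lt_one₀ hqn]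
    nlinarith
  have h1 := schwarz_pick hd hmm (norm_nonneg q) h0 (by
    rw [← hq, inner_self_eq_norm_sq_to_K, hc]
    simp only [Complex.coe_algebraMap]
    rw [← Complex.ofReal_pow, ← Complex.ofReal_mul]
    congr 1
    field_simp)
  have hdd : HasDerivAt (fun ζ => c * inner ℂ q (ψ ζ)) (c * inner ℂ q (deriv ψ 0)) 0 := by
    have h2 : HasDerivAt ψ (deriv ψ 0) 0 :=
      (hψ.differentiableAt (ball_mem_nhds _ one_pos)).hasDerivAt
    exact ((innerSL ℂ q).hasFDerivAt.comp_hasDerivAt (0 : ℂ) h2).const_mul c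
  rw [hdd.deriv, norm_mul, hcn, inv_mul_le_iff₀ hqn] at h1
  nlinarith [mul_nonneg (sub_nonneg.2 h0.le) (show 0 ≤ 1 - ‖q‖ ^ 2 by nlinarith)]

theorem key_claim {D : Set (Cn n)} (hD : IsOpen D) {z w : Cn n} (hw : w ∈ D) {m r : ℝ}
    {g f : Cn n → Cn n}
    (hhyp : z ≠ w → 0 < kobayashi D z w)
    (hne : ∃ γ, IsCurve D γ z w)
    (hg : DifferentiableOn ℂ g (ball 0 1)) (hinj : InjOn g (ball 0 1)) (hg0 : g 0 = z)
    (hfg : ∀ x ∈ ball (0 : Cn n) 1, f (g x) = x)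
    (hcov : {w ∈ D | kobayashi D z w < m} ⊆ g '' ball 0 1) (hmr : r + 1 ≤ m)
    (hr : 0 < r) (hk : kobayashi D z w < r) : ‖f w‖ ^ 2 ≤ 1 - Real.exp (-(4 * r)) := by
  have hexp : Real.exp (-(4 * r)) ≤ 1 := Real.exp_le_one_iff.2 (by linarith)
  rcases eq_or_ne z w with rfl | hzw
  · have : f z = 0 := by rw [← hg0]; exact hfg 0 (mem_ball_self one_pos)
    rw [this, norm_zero]
    simpa using hexp
  obtain ⟨hΩ, hfd⟩ := inj_inverse isOpen_ball hg hinj hfg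
  set Ω := g '' ball 0 1 with hΩd
  have hfb : MapsTo f Ω (ball 0 1) := by
    rintro _ ⟨x, hx, rfl⟩
    rw [hfg x hx]; exact hx
  have hneS : {L : ℝ | ∃ γ : ℝ → Cn n, IsCurve D γ z w ∧ kobLength D γ = L}.Nonempty := by
    obtain ⟨γ, hγ⟩ := hne
    exact ⟨_, γ, hγ, rfl⟩
  obtain ⟨L, ⟨γ, hγ, rfl⟩, hL⟩ := exists_lt_of_csInf_lt hneS hk
  have hintg : IntervalIntegrable (fun t => kappaRoyden D (γ t) (deriv γ t)) MeasureTheory.volume 0 1 := by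
    by_contra hni
    have h1 := kob_le hγ
    rw [kobLength, intervalIntegral.integral_undef hni] at h1
    exact absurd (hhyp hzw) (not_lt.2 h1)
  have hγΩ : MapsTo γ (Icc 0 1) Ω := by
    intro t ht
    obtain ⟨θ, h1, h2⟩ := restrict_curve hD hγ hintg ht
    have h3 := kob_le h1
    exact hcov ⟨hγ.2.1 ht, by linarith⟩
  set q : ℝ → Cn n := fun t => f (γ t) with hq
  have hqlt : ∀ t ∈ Icc (0 : ℝ) 1, 0 < 1 - ‖q t‖ ^ 2 := by
    intro t ht
    have := hfb (hγΩ ht)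
    rw [mem_ball_zero_iff] at this
    nlinarith [norm_nonneg (f (γ t))]
  have hqc : ContinuousOn q (Icc 0 1) := hfd.continuousOn.comp hγ.1.continuousOn hγΩ
  have hqd : ∀ t ∈ Ioo (0 : ℝ) 1, HasDerivAt q (fderiv ℂ f (γ t) (deriv γ t)) t := by
    intro t ht
    have e1 : HasDerivAt γ (deriv γ t) t :=
      ((hγ.1.contDiffAt (Icc_mem_nhds ht.1 ht.2)).differentiableAt (by simp)).hasDerivAt
    have e2 : HasFDerivAt f (fderiv ℂ f (γ t)) (γ t) :=
      (hfd.differentiableAt (hΩ.mem_nhds (hγΩ (Ioo_subset_Icc_self ht)))).hasFDerivAt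
    exact (e2.restrictScalars ℝ).comp_hasDerivAt t e1
  have hNd : ∀ t ∈ Ioo (0 : ℝ) 1, HasDerivAt (fun t => ‖q t‖ ^ 2)
      (2 * (inner ℂ (q t) (fderiv ℂ f (γ t) (deriv γ t))).re) t := by
    intro t ht
    have h1 := ((hqd t ht).inner ℂ (hqd t ht))
    have h2 := (Complex.reCLM.hasFDerivAt.comp_hasDerivAt t h1)
    have e1 : (fun t => ‖q t‖ ^ 2) = Complex.reCLM ∘ (fun t => inner ℂ (q t) (q t)) := by
      ext s
      simp [inner_self_eq_norm_sq_to_K, ← Complex.ofReal_pow]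
    have e2 : 2 * (inner ℂ (q t) (fderiv ℂ f (γ t) (deriv γ t))).re = Complex.reCLM
        (inner ℂ (q t) ((fderiv ℂ f (γ t)) (deriv γ t)) + inner ℂ ((fderiv ℂ f (γ t)) (deriv γ t)) (q t)) := by
      rw [Complex.reCLM_apply, Complex.add_re,
        ← inner_conj_symm ((fderiv ℂ f (γ t)) (deriv γ t)) (q t), Complex.conj_re]
      ring
    rw [e1, e2]
    exact h2
  have hbound : ∀ t ∈ Ioo (0 : ℝ) 1, 2 * (inner ℂ (q t) (fderiv ℂ f (γ t) (deriv γ t))).re ≤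
      4 * kappaRoyden D (γ t) (deriv γ t) * (1 - ‖q t‖ ^ 2) := by
    intro t ht
    have ht' := Ioo_subset_Icc_self ht
    have hpos := hqlt t ht'
    suffices h : 2 * (inner ℂ (q t) (fderiv ℂ f (γ t) (deriv γ t))).re / (4 * (1 - ‖q t‖ ^ 2)) ≤
        kappaRoyden D (γ t) (deriv γ t) by
      rw [div_le_iff₀ (by positivity)] at h
      linarith
    refine le_of_forall_gt_imp_ge_of_dense fun x hx => ?_
    obtain ⟨φ, p1, p2, p3, l, p4, p5⟩ := kappa_exists hD (hγ.2.1 ht') _ hx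
    obtain ⟨θ, t1, t2⟩ := restrict_curve hD hγ hintg ht'
    have hφΩ : ∀ ζ : ℂ, ‖ζ‖ ≤ 1 / 2 → φ ζ ∈ Ω := by
      intro ζ hζ
      obtain ⟨η, h1, h2⟩ := kob_disc p1 p2 hζ
      rw [p3] at h1
      obtain ⟨μ, h3, h4⟩ := glue hD t1 h1
      have h5 := kob_le h3
      refine hcov ⟨p2 (by rw [mem_ball_zero_iff]; linarith), by linarith⟩
    have hhalf : MapsTo (fun ζ : ℂ => (1 / 2 : ℂ) * ζ) (ball 0 1) (ball 0 1) := fun ζ hζ => by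
      rw [mem_ball_zero_iff] at hζ ⊢
      rw [norm_mul]; norm_num; linarith
    have hmφ : MapsTo (fun ζ : ℂ => φ ((1 / 2 : ℂ) * ζ)) (ball 0 1) Ω := by
      intro ζ hζ
      refine hφΩ _ ?_
      rw [mem_ball_zero_iff] at hζ
      rw [norm_mul]; norm_num; linarith
    have hψd : DifferentiableOn ℂ (fun ζ : ℂ => f (φ ((1 / 2 : ℂ) * ζ))) (ball 0 1) :=
      hfd.comp (p1.comp (by fun_prop) hhalf) hmφ
    have hsp := schwarz_pick_ball hψd (hfb.comp hmφ)
    have hψ' : HasDerivAt (fun ζ : ℂ => f (φ ((1 / 2 : ℂ) * ζ)))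
        (fderiv ℂ f (γ t) ((1 / 2 : ℂ) • deriv φ 0)) 0 := by
      have e1 : HasDerivAt (fun ζ : ℂ => (1 / 2 : ℂ) * ζ) (1 / 2 : ℂ) 0 := by
        simpa using (hasDerivAt_id (0 : ℂ)).const_mul (1 / 2 : ℂ)
      have e2 : HasDerivAt φ (deriv φ 0) ((1 / 2 : ℂ) * 0) := by
        rw [mul_zero]
        exact (p1.differentiableAt (ball_mem_nhds _ one_pos)).hasDerivAt
      have e3 : HasFDerivAt f (fderiv ℂ f (γ t)) (φ ((1 / 2 : ℂ) * 0)) := by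
        rw [mul_zero, p3]
        exact (hfd.differentiableAt (hΩ.mem_nhds (hγΩ ht'))).hasFDerivAt
      exact e3.comp_hasDerivAt (0 : ℂ) (e2.scomp (0 : ℂ) e1)
    rw [hψ'.deriv] at hsp
    simp only [mul_zero, p3] at hsp
    have e4 : fderiv ℂ f (γ t) (deriv γ t) = (2 * l) • fderiv ℂ f (γ t) ((1 / 2 : ℂ) • deriv φ 0) := by
      rw [← map_smul, smul_smul, ← p4]
      congr 2
      ring
    rw [div_le_iff₀ (by positivity), e4, inner_smul_right]
    have e5 := Complex.re_le_norm (2 * l * inner ℂ (q t) (fderiv ℂ f (γ t) ((1 / 2 : ℂ) • deriv φ 0)))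
    rw [norm_mul, norm_mul] at e5
    have e6 : ‖(2 : ℂ)‖ = 2 := by simp
    rw [e6] at e5
    have e7 : 2 * ‖l‖ * ‖inner ℂ (q t) (fderiv ℂ f (γ t) ((1 / 2 : ℂ) • deriv φ 0))‖ ≤
        2 * x * (1 - ‖q t‖ ^ 2) := by
      have hx0 : 0 ≤ x := (norm_nonneg l).trans p5.le
      exact mul_le_mul (by linarith [p5.le]) hsp (norm_nonneg _) (by linarith)
    linarith
  have hmain := intervalIntegral.sub_le_integral_of_hasDeriv_right_of_le (a := 0) (b := 1)
    (g := fun t => - Real.log (1 - ‖q t‖ ^ 2))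
    (g' := fun t => (2 * (inner ℂ (q t) (fderiv ℂ f (γ t) (deriv γ t))).re) / (1 - ‖q t‖ ^ 2))
    (φ := fun t => 4 * kappaRoyden D (γ t) (deriv γ t)) zero_le_one ?_ ?_ ?_ ?_
  · rw [intervalIntegral.integral_const_mul] at hmain
    have h1 : q 0 = 0 := by
      simp only [hq]
      rw [hγ.2.2.1, ← hg0]; exact hfg 0 (mem_ball_self one_pos)
    have h2 : q 1 = f w := by simp only [hq]; rw [hγ.2.2.2]
    have hp := hqlt 1 (by simp)
    rw [h2] at hp
    simp only [h1, h2, norm_zero] at hmain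
    norm_num at hmain
    change _ ≤ 4 * kobLength D γ at hmain
    have h3 : -(4 * r) ≤ Real.log (1 - ‖f w‖ ^ 2) := by linarith
    have h4 := (Real.le_log_iff_exp_le hp).1 h3
    linarith
  · exact (ContinuousOn.log (continuousOn_const.sub (hqc.norm.pow 2)) fun t ht => (hqlt t ht).ne').neg
  · intro t ht
    have h1 := ((hNd t ht).const_sub 1).log (hqlt t (Ioo_subset_Icc_self ht)).ne'
    have h2 := h1.neg
    refine HasDerivAt.hasDerivWithinAt ?_
    rw [neg_div, neg_neg] at h2
    exact h2
  · rw [integrableOn_Icc_iff_integrableOn_Ioc, ← intervalIntegrable_iff_integrableOn_Ioc_of_le zero_le_one]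
    exact hintg.const_mul 4
  · intro t ht
    rw [div_le_iff₀ (hqlt t (Ioo_subset_Icc_self ht))]
    exact hbound t ht

end partH

section partI
open Set Metric Filter Topology

theorem ult_lim {ι X : Type*} [TopologicalSpace X] (U : Ultrafilter ι) {s : Set X} (hs : IsCompact s)
    {u : ι → X} (hu : ∀ᶠ j in (U : Filter ι), u j ∈ s) :
    ∃ x ∈ s, Tendsto u U (𝓝 x) := by
  obtain ⟨x, hx, h⟩ := hs.ultrafilter_le_nhds (U.map u) (by
    rw [le_principal_iff]
    exact hu)
  exact ⟨x, hx, h⟩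

theorem equi_lim {ι : Type*} {l : Filter ι} {f : ι → Cn n → Cn n} {c : Cn n} {R M : ℝ} (hR : 0 < R)
    (hf : ∀ᶠ j in l, DifferentiableOn ℂ (f j) (ball c R) ∧ ∀ x ∈ ball c R, ‖f j x‖ ≤ M)
    {u : ι → Cn n} (hu : Tendsto u l (𝓝 c)) {y : Cn n} (hy : ∀ᶠ j in l, f j (u j) = y) :
    Tendsto (fun j => f j c) l (𝓝 y) := by
  rw [tendsto_iff_norm_sub_tendsto_zero] at hu ⊢
  have h1 : Tendsto (fun j => 2 * M / R * ‖u j - c‖) l (𝓝 0) := by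
    simpa using hu.const_mul (2 * M / R)
  refine squeeze_zero' (Eventually.of_forall fun _ => norm_nonneg _) ?_ h1
  filter_upwards [hf, hy, hu.eventually (gt_mem_nhds hR)] with j h2 h3 h4
  have h5 := sv_lip_bound h2.1 h2.2 (z := u j) (by rwa [mem_ball, dist_eq_norm])
  rw [h3] at h5
  rwa [norm_sub_rev]

theorem final_aux {n : ℕ} (D : Set (Cn n)) (hD : IsOpen D)
    (hDconn : IsConnected D)
    (hhyp : ∀ z ∈ D, ∀ w ∈ D, z ≠ w → 0 < kobayashi D z w)
    (z : Cn n) (hz : z ∈ D)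
    (hfull : ∀ r : ℝ, 0 < r → ∃ g : Cn n → Cn n, DifferentiableOn ℂ g (ball 0 1) ∧
      InjOn g (ball 0 1) ∧ MapsTo g (ball 0 1) D ∧
      {w ∈ D | kobayashi D z w < r} ⊆ g '' ball 0 1) :
    ∃ F : Cn n → Cn n, DifferentiableOn ℂ F D ∧ InjOn F D ∧
      F '' D = ball (0 : Cn n) 1 := by
  have hex : ∀ j : ℕ, ∃ g : Cn n → Cn n, DifferentiableOn ℂ g (ball 0 1) ∧
      InjOn g (ball 0 1) ∧ MapsTo g (ball 0 1) D ∧ g 0 = z ∧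
      {w ∈ D | kobayashi D z w < (j : ℝ) + 1} ⊆ g '' ball 0 1 := by
    intro j
    have hj : (0 : ℝ) < (j : ℝ) + 1 := by positivity
    obtain ⟨g, h1, h2, h3, h4⟩ := hfull ((j : ℝ) + 1) hj
    obtain ⟨g', a1, a2, a3, a4, a5⟩ := mob_renorm h1 h2 h3
      (h4 ⟨hz, (kob_self_nonpos hz hD).trans_lt hj⟩)
    exact ⟨g', a1, a2, a3, a4, by rw [a5]; exact h4⟩
  choose g hg hinj hm hg0 hcov using hex
  set f : ℕ → Cn n → Cn n := fun j => Function.invFunOn (g j) (ball 0 1) with hf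
  have hfg : ∀ j, ∀ x ∈ ball (0 : Cn n) 1, f j (g j x) = x := fun j x hx =>
    (hinj j).leftInvOn_invFunOn hx
  have hfd : ∀ j, DifferentiableOn ℂ (f j) (g j '' ball 0 1) := fun j =>
    (inj_inverse isOpen_ball (hg j) (hinj j) (hfg j)).2
  have hfb : ∀ j, ∀ w ∈ g j '' ball 0 1, f j w ∈ ball (0 : Cn n) 1 ∧ g j (f j w) = w := by
    rintro j _ ⟨x, hx, rfl⟩
    rw [hfg j x hx]
    exact ⟨hx, rfl⟩
  have hkey : ∀ w ∈ D, ∀ r : ℝ, 0 < r → kobayashi D z w < r → ∀ j : ℕ, r ≤ j →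
      ‖f j w‖ ^ 2 ≤ 1 - Real.exp (-(4 * r)) := by
    intro w hw r hr hk j hj
    exact key_claim hD hw (hhyp z hz w hw) (exists_curve hD hDconn hz hw) (hg j) (hinj j) (hg0 j)
      (hfg j) (hcov j) (by linarith) hr hk
  have hK : ∀ ρ : ℝ, 0 ≤ ρ → ρ < 1 → ∃ K, IsCompact K ∧ K ⊆ D ∧ ∀ j, ∀ x : Cn n, ‖x‖ ≤ ρ → g j x ∈ K := by
    intro ρ hρ hρ1
    have hq : 0 ≤ ρ / (1 - ρ) := div_nonneg hρ (by linarith)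
    set r := ρ / (1 - ρ) + 1 with hr
    obtain ⟨m, hmr⟩ := exists_nat_ge r
    set τ := Real.sqrt (1 - Real.exp (-(4 * r))) with hτ
    have hτ1 : τ < 1 := by
      rw [hτ, Real.sqrt_lt' one_pos]
      linarith [Real.exp_pos (-(4 * r))]
    have hsub : closedBall (0 : Cn n) τ ⊆ ball 0 1 := closedBall_subset_ball hτ1
    refine ⟨g m '' closedBall 0 τ, (isCompact_closedBall _ _).image_of_continuousOn
      ((hg m).continuousOn.mono hsub), ?_, ?_⟩
    · rintro _ ⟨x, hx, rfl⟩
      exact hm m (hsub hx)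
    · intro j x hx
      have h1 := kob_ball_bdd (hg j) (hm j) hx hρ1
      rw [hg0 j] at h1
      have hpD : g j x ∈ D := hm j (by rw [mem_ball_zero_iff]; linarith)
      have h2 : kobayashi D z (g j x) < r := by linarith
      have h3 := hkey _ hpD r (by linarith) h2 m hmr
      refine ⟨f m (g j x), ?_, (hfb m _ (hcov m ⟨hpD, by linarith⟩)).2⟩
      rw [mem_closedBall_zero_iff]
      exact Real.le_sqrt_of_sq_le h3
  set U : Ultrafilter ℕ := Ultrafilter.of atTop with hU
  have hUle : (U : Filter ℕ) ≤ atTop := Ultrafilter.of_le _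
  have hlarge : ∀ C : ℝ, ∀ᶠ j : ℕ in (U : Filter ℕ), C ≤ j := by
    intro C
    exact hUle (tendsto_natCast_atTop_atTop.eventually (eventually_ge_atTop C))
  have hFex : ∀ w, w ∈ D → ∃ y, y ∈ ball (0 : Cn n) 1 ∧ Tendsto (fun j => f j w) U (𝓝 y) := by
    intro w hw
    set r := |kobayashi D z w| + 1 with hr
    have hr1 : 0 < r := by positivity
    have hr2 : kobayashi D z w < r := by linarith [le_abs_self (kobayashi D z w)]
    obtain ⟨y, hy, h⟩ := ult_lim U (isCompact_closedBall (0 : Cn n) (Real.sqrt (1 - Real.exp (-(4 * r)))))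
      (u := fun j => f j w) (by
        filter_upwards [hlarge r] with j hj
        rw [mem_closedBall_zero_iff]
        exact Real.le_sqrt_of_sq_le (hkey w hw r hr1 hr2 j hj))
    refine ⟨y, closedBall_subset_ball ?_ hy, h⟩
    rw [Real.sqrt_lt' one_pos]
    linarith [Real.exp_pos (-(4 * r))]
  have hGex : ∀ x, x ∈ ball (0 : Cn n) 1 → ∃ y, y ∈ D ∧ Tendsto (fun j => g j x) U (𝓝 y) := by
    intro x hx
    rw [mem_ball_zero_iff] at hx
    obtain ⟨K, k1, k2, k3⟩ := hK ‖x‖ (norm_nonneg x) hx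
    obtain ⟨y, hy, h⟩ := ult_lim U k1 (u := fun j => g j x) (Eventually.of_forall fun j => k3 j x le_rfl)
    exact ⟨y, k2 hy, h⟩
  choose! F hF1 hF2 using hFex
  choose! G hG1 hG2 using hGex
  have hloc : ∀ w ∈ D, ∃ ε > 0, ball w ε ⊆ D ∧ ∀ᶠ j in (U : Filter ℕ),
      DifferentiableOn ℂ (f j) (ball w ε) ∧ ∀ x ∈ ball w ε, ‖f j x‖ ≤ 1 := by
    intro w hw
    obtain ⟨ε, hε, C, hC, h1, h2⟩ := kob_loc_bdd hD hDconn hz hw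
    refine ⟨ε, hε, h1, ?_⟩
    filter_upwards [hlarge C] with j hj
    have h3 : ball w ε ⊆ g j '' ball 0 1 := fun x hx => hcov j ⟨h1 hx, by linarith [h2 x hx]⟩
    refine ⟨(hfd j).mono h3, fun x hx => ?_⟩
    have := (hfb j x (h3 hx)).1
    rw [mem_ball_zero_iff] at this
    exact this.le
  have hFG : ∀ x ∈ ball (0 : Cn n) 1, F (G x) = x := by
    intro x hx
    obtain ⟨ε, hε, -, h⟩ := hloc (G x) (hG1 x hx)
    exact tendsto_nhds_unique (hF2 _ (hG1 x hx))
      (equi_lim hε h (hG2 x hx) (Eventually.of_forall fun j => hfg j x hx))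
  have hGF : ∀ w ∈ D, G (F w) = w := by
    intro w hw
    have hy := hF1 w hw
    have hy' := hy
    rw [mem_ball_zero_iff] at hy'
    have hn := norm_nonneg (F w)
    obtain ⟨K, k1, k2, k3⟩ := hK ((1 + ‖F w‖) / 2) (by linarith) (by linarith)
    obtain ⟨M, hM⟩ := k1.isBounded.exists_norm_le
    have hb : ∀ x ∈ ball (F w) ((1 - ‖F w‖) / 2), ‖x‖ ≤ (1 + ‖F w‖) / 2 := by
      intro x hx
      rw [mem_ball, dist_eq_norm] at hx
      have := norm_le_norm_add_norm_sub' x (F w)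
      linarith
    refine tendsto_nhds_unique (hG2 _ hy) (equi_lim (R := (1 - ‖F w‖) / 2) (M := M) (by linarith) ?_ (hF2 w hw) ?_)
    · refine Eventually.of_forall fun j => ⟨(hg j).mono fun x hx => ?_, fun x hx => hM _ (k3 j x (hb x hx))⟩
      rw [mem_ball_zero_iff]
      linarith [hb x hx]
    · filter_upwards [hlarge (kobayashi D z w)] with j hj
      exact (hfb j w (hcov j ⟨hw, by linarith⟩)).2
  refine ⟨F, ?_, ?_, ?_⟩
  · intro w hw
    obtain ⟨ε, hε, h1, h2⟩ := hloc w hw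
    exact (sv_limit U hε h2 fun x hx => hF2 x (h1 hx)).differentiableWithinAt
  · intro a ha b hb hab
    rw [← hGF a ha, ← hGF b hb, hab]
  · ext y
    constructor
    · rintro ⟨w, hw, rfl⟩
      exact hF1 w hw
    · intro hy
      exact ⟨G y, hG1 y hy, hFG y hy⟩

end partI

/-- if `D ⊆ ℂⁿ` is a `k`-hyperbolic domain, `z ∈ D`, and
`h^k_D(z) = 1` (i.e. every Kobayashi ball `B^k_D(z,r)` is contained in the image
of some injective holomorphic map `g : 𝔹ₙ → D`), then `D` is biholomorphic to
the unit ball `𝔹ₙ`. -/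
theorem biholo_ball_of_fridman_one {n : ℕ} (D : Set (Cn n)) (hD : IsOpen D)
    (hDconn : IsConnected D)
    (hhyp : ∀ z ∈ D, ∀ w ∈ D, z ≠ w → 0 < kobayashi D z w)
    (z : Cn n) (hz : z ∈ D)
    (hfull : ∀ r : ℝ, 0 < r → ∃ g : Cn n → Cn n, DifferentiableOn ℂ g (ball 0 1) ∧
      InjOn g (ball 0 1) ∧ MapsTo g (ball 0 1) D ∧
      {w ∈ D | kobayashi D z w < r} ⊆ g '' ball 0 1) :
    ∃ F : Cn n → Cn n, DifferentiableOn ℂ F D ∧ InjOn F D ∧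
      F '' D = ball (0 : Cn n) 1 :=
  final_aux D hD hDconn hhyp z hz hfull

end
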